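/- Assume l > 1. Let f̃ : (V(0),∞) → ℝ be C^∞ of class S̃^m with m < l, and let ε ∈ ℝ satisfy 1 + ε f̃′(E) ≥ 1/2 for all E > V(0). Set h₁(x,ξ) := h₀(x,ξ) + ε f̃(h₀(x,ξ)). Let p ∈ S^{m₁,m₂} vanish on {(x,ξ) : h₀(x,ξ) ≤ E₀} for some E₀ > V(0), and extend ⟨p⟩ by 0 for E ≤ E₀. Then there exists χ ∈ S^{m₁+[m₂]−l+1,0} with ∂_x χ ∈ S^{m₁+[m₂]−l,0} such that p(x,ξ) + {h₁;χ}(x,ξ) = ⟨p⟩(h₀(x,ξ)) for all (x,ξ) ∈ ℝ². -/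

import Mathlib

open Real MeasureTheory intervalIntegral

noncomputable section

/-- Japanese bracket `⟨x⟩ = √(1+x²)`. -/
def jap (x : ℝ) : ℝ := Real.sqrt (1 + x ^ 2)

/-- The weight `λ(x,ξ) = (1+ξ²+|x|^{2l})^{1/(2l)}`. -/
def lam (l x ξ : ℝ) : ℝ := (1 + ξ ^ 2 + |x| ^ (2 * l)) ^ (1 / (2 * l))

/-- The symbol class `S^{m₁,m₂}`:  `g ∈ C^∞(ℝ²)` with
`|∂_ξ^{k₁}∂_x^{k₂} g(x,ξ)| ≤ C λ(x,ξ)^{m₁-k₁ l} ⟨x⟩^{m₂-k₂}`. -/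
def IsSymbol (l m₁ m₂ : ℝ) (g : ℝ → ℝ → ℝ) : Prop :=
  ContDiff ℝ (⊤ : ℕ∞) (fun q : ℝ × ℝ => g q.1 q.2) ∧
  ∀ k₁ k₂ : ℕ, ∃ C : ℝ, ∀ x ξ : ℝ,
    |iteratedDeriv k₁ (fun ξ' => iteratedDeriv k₂ (fun x' => g x' ξ') x) ξ|
      ≤ C * lam l x ξ ^ (m₁ - (k₁ : ℝ) * l) * jap x ^ (m₂ - (k₂ : ℝ))

/-- The standing assumptions on the potential `V`: it is `C^∞`, even, has no critical
points away from `0`, satisfies the symbol bounds `|∂_x^k V| ≤ C_k ⟨x⟩^{2l-k}`, and admits an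
asymptotic expansion `V(x) ∼ |x|^{2l} + Σ_{j≥1} V_{2l-2j}(x)` with `V_{2l-2j}` smooth away
from zero and positively homogeneous of degree `2l-2j`. -/
structure GoodPotential (l : ℝ) (V : ℝ → ℝ) : Prop where
  smooth : ContDiff ℝ (⊤ : ℕ∞) V
  even : ∀ x : ℝ, V (-x) = V x
  deriv_ne : ∀ x : ℝ, x ≠ 0 → deriv V x ≠ 0
  growth : ∀ k : ℕ, ∃ C : ℝ, ∀ x : ℝ, |iteratedDeriv k V x| ≤ C * jap x ^ (2 * l - (k : ℝ))
  expansion : ∃ Vh : ℕ → ℝ → ℝ,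
    (∀ j : ℕ, 1 ≤ j →
      ContDiffOn ℝ (⊤ : ℕ∞) (Vh j) {x : ℝ | x ≠ 0} ∧
      ∀ ρ : ℝ, 0 < ρ → ∀ x : ℝ, Vh j (ρ * x) = ρ ^ (2 * l - 2 * (j : ℝ)) * Vh j x) ∧
    ∀ N k : ℕ, ∃ C R : ℝ, ∀ x : ℝ, R ≤ |x| →
      |iteratedDeriv k (fun y => V y - |y| ^ (2 * l) - ∑ j ∈ Finset.Icc 1 N, Vh j y) x|
        ≤ C * |x| ^ (2 * l - 2 * ((N : ℝ) + 1) - (k : ℝ))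

/-- `qM` is the turning point function: the unique positive solution of `V(q_M(E)) = E`
for `E > V 0`. -/
def IsTurningPoint (V qM : ℝ → ℝ) : Prop :=
  ∀ E : ℝ, V 0 < E →
    0 < qM E ∧ V (qM E) = E ∧ ∀ q : ℝ, 0 < q → V q = E → q = qM E

/-- The period `T(E) = 4∫₀^{q_M(E)} dq/√(E-V(q))`. -/
def period (V qM : ℝ → ℝ) (E : ℝ) : ℝ :=
  4 * ∫ q in (0:ℝ)..(qM E), (Real.sqrt (E - V q))⁻¹

/-- The orbit average
`⟨p⟩(E) = (1/T(E)) ∫_{-q_M}^{q_M} [p(q,√(E-V q)) + p(q,-√(E-V q))]/√(E-V q) dq`. -/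
def orbitAvg (V qM : ℝ → ℝ) (p : ℝ → ℝ → ℝ) (E : ℝ) : ℝ :=
  (period V qM E)⁻¹ *
    ∫ q in (-(qM E))..(qM E),
      (p q (Real.sqrt (E - V q)) + p q (-Real.sqrt (E - V q))) / Real.sqrt (E - V q)

/-- The Poisson bracket `{a;b} = -∂_ξa ∂_xb + ∂_ξb ∂_xa`. -/
def pbr (a b : ℝ → ℝ → ℝ) (x ξ : ℝ) : ℝ :=
  -(deriv (fun ξ' => a x ξ') ξ) * (deriv (fun x' => b x' ξ) x)
    + (deriv (fun ξ' => b x ξ') ξ) * (deriv (fun x' => a x' ξ) x)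

/-- A continuous function on `ℝ × O` is bounded on `[0,1] × B` for a small ball `B` around any
point of the open set `O`. -/
theorem exists_ball_bound {H E : Type*} [NormedAddCommGroup H] [ProperSpace H]
    [NormedAddCommGroup E] {f : ℝ × H → E} {O : Set H} (hO : IsOpen O)
    (hf : ContinuousOn f (Set.univ ×ˢ O)) {y₀ : H} (hy₀ : y₀ ∈ O) :
    ∃ r > 0, Metric.ball y₀ r ⊆ O ∧
      ∃ C, ∀ s ∈ Set.Icc (0 : ℝ) 1, ∀ y ∈ Metric.ball y₀ r, ‖f (s, y)‖ ≤ C := by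
  obtain ⟨r, hr, hrO⟩ := Metric.nhds_basis_closedBall.mem_iff.1 (hO.mem_nhds hy₀)
  obtain ⟨C, hC⟩ := (isCompact_Icc.prod (isCompact_closedBall y₀ r)).exists_bound_of_continuousOn
    (hf.mono (Set.prod_mono (Set.subset_univ (Set.Icc (0 : ℝ) 1)) hrO))
  exact ⟨r, hr, Metric.ball_subset_closedBall.trans hrO, C,
    fun s hs y hy => hC _ ⟨hs, Metric.ball_subset_closedBall hy⟩⟩

theorem continuous_section {H E : Type*} [TopologicalSpace H] [TopologicalSpace E]
    {f : ℝ × H → E} {O : Set H} (hf : ContinuousOn f (Set.univ ×ˢ O)) {y : H} (hy : y ∈ O) :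
    Continuous fun s => f (s, y) :=
  hf.comp_continuous (by fun_prop) fun s => ⟨Set.mem_univ s, hy⟩

/-- Integrals over `[0,1]` of jointly `C^n` functions are `C^n` in the parameter. -/
theorem contDiffOn_integral_param {H : Type} [NormedAddCommGroup H] [NormedSpace ℝ H]
    [ProperSpace H] {O : Set H} (hO : IsOpen O) (n : ℕ) :
    ∀ {E : Type} [NormedAddCommGroup E] [NormedSpace ℝ E] [CompleteSpace E] {k : ℝ × H → E},
      ContDiffOn ℝ n k (Set.univ ×ˢ O) →
        ContDiffOn ℝ n (fun y => ∫ s in (0 : ℝ)..1, k (s, y)) O := by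
  have hΩ : IsOpen ((Set.univ : Set ℝ) ×ˢ O) := isOpen_univ.prod hO
  induction n with
  | zero =>
    intro E _ _ _ k hk
    have hc := hk.continuousOn
    rw [Nat.cast_zero, contDiffOn_zero]
    intro y₀ hy₀
    obtain ⟨r, hr, hrO, C, hC⟩ := exists_ball_bound hO hc hy₀
    refine ContinuousAt.continuousWithinAt ?_
    refine continuousAt_of_dominated_interval (bound := fun _ => C) ?_ ?_ (by simp) ?_
    · filter_upwards [Metric.ball_mem_nhds y₀ hr] with y hy
      exact (continuous_section hc (hrO hy)).aestronglyMeasurable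
    · filter_upwards [Metric.ball_mem_nhds y₀ hr] with y hy
      refine Filter.Eventually.of_forall fun t ht => hC t ?_ y hy
      rw [Set.uIoc_of_le zero_le_one] at ht
      exact ⟨ht.1.le, ht.2⟩
    · refine Filter.Eventually.of_forall fun t _ => ?_
      have h1 := hc.continuousAt (hΩ.mem_nhds (Set.mk_mem_prod (Set.mem_univ t) hy₀))
      exact ContinuousAt.comp (f := fun y => (t, y)) h1 (by fun_prop)
  | succ n ih =>
    intro E _ _ _ k hk
    have hk' := hk
    rw [Nat.cast_succ, contDiffOn_succ_iff_fderiv_of_isOpen hΩ] at hk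
    have hc := hk'.continuousOn
    have hfd : ContDiffOn ℝ n (fun z => (fderiv ℝ k z).comp (ContinuousLinearMap.inr ℝ ℝ H))
        (Set.univ ×ˢ O) := hk.2.2.clm_comp contDiffOn_const
    have hder : ∀ y₀ ∈ O, HasFDerivAt (fun y => ∫ s in (0 : ℝ)..1, k (s, y))
        (∫ s in (0 : ℝ)..1, (fderiv ℝ k (s, y₀)).comp (ContinuousLinearMap.inr ℝ ℝ H)) y₀ := by
      intro y₀ hy₀
      obtain ⟨r, hr, hrO, C, hC⟩ := exists_ball_bound hO hfd.continuousOn hy₀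
      refine hasFDerivAt_integral_of_dominated_of_fderiv_le (bound := fun _ => C)
        (F := fun y s => k (s, y))
        (F' := fun y s => (fderiv ℝ k (s, y)).comp (ContinuousLinearMap.inr ℝ ℝ H))
        (Metric.ball_mem_nhds y₀ hr) ?_ ?_ ?_ ?_ (by simp) ?_
      · filter_upwards [Metric.ball_mem_nhds y₀ hr] with y hy
        exact (continuous_section hc (hrO hy)).aestronglyMeasurable
      · exact (continuous_section hc hy₀).intervalIntegrable _ _
      · exact (continuous_section hfd.continuousOn hy₀).aestronglyMeasurable
      · refine Filter.Eventually.of_forall fun t ht y hy => hC t ?_ y hy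
        rw [Set.uIoc_of_le zero_le_one] at ht
        exact ⟨ht.1.le, ht.2⟩
      · refine Filter.Eventually.of_forall fun t _ y hy => ?_
        have h1 : HasFDerivAt k (fderiv ℝ k (t, y)) (t, y) :=
          (hk.1.differentiableAt (hΩ.mem_nhds ⟨Set.mem_univ t, hrO hy⟩)).hasFDerivAt
        exact HasFDerivAt.comp (f := fun y => (t, y)) y h1 (hasFDerivAt_prodMk_right t y)
    rw [Nat.cast_succ, contDiffOn_succ_iff_fderiv_of_isOpen hO]
    refine ⟨fun y hy => (hder y hy).differentiableAt.differentiableWithinAt, by simp, ?_⟩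
    exact (ih hfd).congr fun y hy => (hder y hy).fderiv

theorem contDiffOn_infty_integral_param {H : Type} [NormedAddCommGroup H] [NormedSpace ℝ H]
    [ProperSpace H] {O : Set H} (hO : IsOpen O) {k : ℝ × H → ℝ}
    (hk : ContDiffOn ℝ (⊤ : ℕ∞) k (Set.univ ×ˢ O)) :
    ContDiffOn ℝ (⊤ : ℕ∞) (fun y => ∫ s in (0 : ℝ)..1, k (s, y)) O :=
  contDiffOn_infty.2 fun n => contDiffOn_integral_param hO n (contDiffOn_infty.1 hk n)

/-- The primitive in the first variable, from the base point `0`, of a function which is smooth on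
`ℝ × O`, is smooth on `ℝ × O`. -/
theorem contDiffOn_primitive_param {O : Set ℝ} (hO : IsOpen O) {K : ℝ × ℝ → ℝ}
    (hK : ContDiffOn ℝ (⊤ : ℕ∞) K (Set.univ ×ˢ O)) :
    ContDiffOn ℝ (⊤ : ℕ∞) (fun y : ℝ × ℝ => ∫ s in (0 : ℝ)..y.1, K (s, y.2))
      (Set.univ ×ˢ O) := by
  have h1 : ContDiffOn ℝ (⊤ : ℕ∞) (fun w : ℝ × ℝ × ℝ => K (w.2.1 * w.1, w.2.2))
      (Set.univ ×ˢ (Set.univ ×ˢ O)) :=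
    hK.comp (by fun_prop) fun w hw => ⟨Set.mem_univ _, hw.2.2⟩
  refine ((contDiffOn_fst (s := Set.univ ×ˢ O)).mul
    (contDiffOn_infty_integral_param (isOpen_univ.prod hO) h1)).congr fun y _ => ?_
  have := intervalIntegral.smul_integral_comp_mul_left (a := 0) (b := 1)
    (fun s => K (s, y.2)) y.1
  simp only [mul_zero, mul_one, smul_eq_mul] at this
  exact this.symm

theorem one_le_jap (x : ℝ) : 1 ≤ jap x := by
  rw [jap, Real.one_le_sqrt]; nlinarith [sq_nonneg x]

theorem jap_pos (x : ℝ) : 0 < jap x := zero_lt_one.trans_le (one_le_jap x)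

theorem abs_le_jap (x : ℝ) : |x| ≤ jap x := Real.abs_le_sqrt (by linarith)

theorem jap_le_one_add_abs (x : ℝ) : jap x ≤ 1 + |x| := by
  rw [jap, Real.sqrt_le_left (by positivity)]
  nlinarith [abs_nonneg x, sq_abs x]

theorem one_le_lam_base (l x ξ : ℝ) : 1 ≤ 1 + ξ ^ 2 + |x| ^ (2 * l) := by
  have := Real.rpow_nonneg (abs_nonneg x) (2 * l)
  nlinarith [sq_nonneg ξ]

theorem one_le_lam {l : ℝ} (hl : 0 < l) (x ξ : ℝ) : 1 ≤ lam l x ξ :=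
  Real.one_le_rpow (one_le_lam_base l x ξ) (by positivity)

theorem lam_pos {l : ℝ} (hl : 0 < l) (x ξ : ℝ) : 0 < lam l x ξ :=
  zero_lt_one.trans_le (one_le_lam hl x ξ)

theorem lam_rpow {l : ℝ} (hl : 0 < l) (x ξ : ℝ) :
    lam l x ξ ^ (2 * l) = 1 + ξ ^ 2 + |x| ^ (2 * l) := by
  rw [lam, ← Real.rpow_mul (zero_le_one.trans (one_le_lam_base l x ξ)),
    one_div_mul_cancel (by positivity), Real.rpow_one]

theorem abs_le_lam {l : ℝ} (hl : 0 < l) (x ξ : ℝ) : |x| ≤ lam l x ξ := by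
  rw [← Real.rpow_le_rpow_iff (abs_nonneg x) (lam_pos hl x ξ).le (show 0 < 2 * l by positivity),
    lam_rpow hl]
  nlinarith [sq_nonneg ξ]

theorem abs_le_lam_rpow {l : ℝ} (hl : 0 < l) (x ξ : ℝ) : |ξ| ≤ lam l x ξ ^ l := by
  refine abs_le_of_sq_le_sq ?_ (Real.rpow_nonneg (lam_pos hl x ξ).le l)
  rw [← Real.rpow_natCast, ← Real.rpow_natCast, ← Real.rpow_mul (lam_pos hl x ξ).le, mul_comm l]
  push_cast
  rw [lam_rpow hl]
  have := Real.rpow_nonneg (abs_nonneg x) (2 * l)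
  norm_num; linarith

theorem jap_le_two_mul_lam {l : ℝ} (hl : 0 < l) (x ξ : ℝ) : jap x ≤ 2 * lam l x ξ := by
  linarith [jap_le_one_add_abs x, abs_le_lam hl x ξ, one_le_lam hl x ξ]

/-- The weight of the symbol class `S^{a,b}`. -/
def wt (l a b : ℝ) (z : ℝ × ℝ) : ℝ := lam l z.1 z.2 ^ a * jap z.1 ^ b

theorem wt_pos {l : ℝ} (hl : 0 < l) (a b : ℝ) (z : ℝ × ℝ) : 0 < wt l a b z :=
  mul_pos (Real.rpow_pos_of_pos (lam_pos hl _ _) _) (Real.rpow_pos_of_pos (jap_pos _) _)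

theorem wt_mul {l : ℝ} (hl : 0 < l) (a b a' b' : ℝ) (z : ℝ × ℝ) :
    wt l a b z * wt l a' b' z = wt l (a + a') (b + b') z := by
  simp only [wt, Real.rpow_add (lam_pos hl z.1 z.2), Real.rpow_add (jap_pos z.1)]
  ring

theorem wt_le {l : ℝ} (hl : 0 < l) {a b a' b' : ℝ} (h1 : a ≤ a') (h2 : a + b ≤ a' + b') :
    ∃ C, 0 ≤ C ∧ ∀ z, wt l a b z ≤ C * wt l a' b' z := by
  obtain ⟨C, hC, h⟩ : ∃ C, 0 ≤ C ∧ ∀ z : ℝ × ℝ, 1 ≤ C * wt l (a' - a) (b' - b) z := by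
    rcases le_total b b' with hb | hb
    · exact ⟨1, zero_le_one, fun z => by
        rw [one_mul]
        exact one_le_mul_of_one_le_of_one_le
          (Real.one_le_rpow (one_le_lam hl _ _) (sub_nonneg.2 h1))
          (Real.one_le_rpow (one_le_jap _) (sub_nonneg.2 hb))⟩
    · refine ⟨2 ^ (b - b'), by positivity, fun z => ?_⟩
      have hL := lam_pos hl z.1 z.2
      have h3 : jap z.1 ^ (b - b') ≤ 2 ^ (b - b') * lam l z.1 z.2 ^ (a' - a) :=
        calc jap z.1 ^ (b - b') ≤ (2 * lam l z.1 z.2) ^ (b - b') :=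
              Real.rpow_le_rpow (jap_pos _).le (jap_le_two_mul_lam hl _ _) (by linarith)
          _ = 2 ^ (b - b') * lam l z.1 z.2 ^ (b - b') := Real.mul_rpow (by norm_num) hL.le
          _ ≤ _ := by
              exact mul_le_mul_of_nonneg_left (Real.rpow_le_rpow_of_exponent_le
                (one_le_lam hl _ _) (by linarith)) (by positivity)
      calc (1 : ℝ) = jap z.1 ^ (b - b') * jap z.1 ^ (b' - b) := by
            rw [← Real.rpow_add (jap_pos _)]; simp
        _ ≤ (2 ^ (b - b') * lam l z.1 z.2 ^ (a' - a)) * jap z.1 ^ (b' - b) :=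
            mul_le_mul_of_nonneg_right h3 (Real.rpow_nonneg (jap_pos _).le _)
        _ = _ := by rw [wt, mul_assoc]
  refine ⟨C, hC, fun z => ?_⟩
  have h4 := mul_le_mul_of_nonneg_left (h z) (wt_pos hl a b z).le
  have h5 := wt_mul hl a b (a' - a) (b' - b) z
  rw [show a + (a' - a) = a' by ring, show b + (b' - b) = b' by ring] at h5
  calc wt l a b z = wt l a b z * 1 := (mul_one _).symm
    _ ≤ wt l a b z * (C * wt l (a' - a) (b' - b) z) := h4
    _ = C * wt l a' b' z := by rw [← h5]; ring

/-- The partial derivative in the first (position) variable. -/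
def dPos (g : ℝ × ℝ → ℝ) (z : ℝ × ℝ) : ℝ := fderiv ℝ g z (1, 0)

/-- The partial derivative in the second (momentum) variable. -/
def dMom (g : ℝ × ℝ → ℝ) (z : ℝ × ℝ) : ℝ := fderiv ℝ g z (0, 1)

theorem dPos_smooth {U : Set (ℝ × ℝ)} (hU : IsOpen U) {g : ℝ × ℝ → ℝ}
    (hg : ContDiffOn ℝ (⊤ : ℕ∞) g U) : ContDiffOn ℝ (⊤ : ℕ∞) (dPos g) U :=
  (hg.fderiv_of_isOpen hU (m := (⊤ : ℕ∞)) (by simp)).clm_apply contDiffOn_const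

theorem dMom_smooth {U : Set (ℝ × ℝ)} (hU : IsOpen U) {g : ℝ × ℝ → ℝ}
    (hg : ContDiffOn ℝ (⊤ : ℕ∞) g U) : ContDiffOn ℝ (⊤ : ℕ∞) (dMom g) U :=
  (hg.fderiv_of_isOpen hU (m := (⊤ : ℕ∞)) (by simp)).clm_apply contDiffOn_const

theorem smooth_differentiableAt {U : Set (ℝ × ℝ)} (hU : IsOpen U) {g : ℝ × ℝ → ℝ}
    (hg : ContDiffOn ℝ (⊤ : ℕ∞) g U) {z : ℝ × ℝ} (hz : z ∈ U) : DifferentiableAt ℝ g z :=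
  (hg.contDiffAt (hU.mem_nhds hz)).differentiableAt (by simp)

theorem dPos_congr {U : Set (ℝ × ℝ)} (hU : IsOpen U) {g h : ℝ × ℝ → ℝ} (e : Set.EqOn g h U) :
    Set.EqOn (dPos g) (dPos h) U := fun z hz => by
  rw [dPos, dPos, (e.eventuallyEq_of_mem (hU.mem_nhds hz)).fderiv_eq]

theorem dMom_congr {U : Set (ℝ × ℝ)} (hU : IsOpen U) {g h : ℝ × ℝ → ℝ} (e : Set.EqOn g h U) :
    Set.EqOn (dMom g) (dMom h) U := fun z hz => by
  rw [dMom, dMom, (e.eventuallyEq_of_mem (hU.mem_nhds hz)).fderiv_eq]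

theorem dPos_add {g h : ℝ × ℝ → ℝ} {z : ℝ × ℝ} (hg : DifferentiableAt ℝ g z)
    (hh : DifferentiableAt ℝ h z) :
    dPos (fun w => g w + h w) z = dPos g z + dPos h z := by
  simp [dPos, fderiv_fun_add hg hh]

theorem dMom_add {g h : ℝ × ℝ → ℝ} {z : ℝ × ℝ} (hg : DifferentiableAt ℝ g z)
    (hh : DifferentiableAt ℝ h z) :
    dMom (fun w => g w + h w) z = dMom g z + dMom h z := by
  simp [dMom, fderiv_fun_add hg hh]

theorem dPos_mul {g h : ℝ × ℝ → ℝ} {z : ℝ × ℝ} (hg : DifferentiableAt ℝ g z)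
    (hh : DifferentiableAt ℝ h z) :
    dPos (fun w => g w * h w) z = g z * dPos h z + dPos g z * h z := by
  simp [dPos, fderiv_fun_mul hg hh]; ring

theorem dMom_mul {g h : ℝ × ℝ → ℝ} {z : ℝ × ℝ} (hg : DifferentiableAt ℝ g z)
    (hh : DifferentiableAt ℝ h z) :
    dMom (fun w => g w * h w) z = g z * dMom h z + dMom g z * h z := by
  simp [dMom, fderiv_fun_mul hg hh]; ring

theorem dPos_const (c : ℝ) : dPos (fun _ => c) = fun _ => 0 := by
  funext z; simp [dPos]

theorem dMom_const (c : ℝ) : dMom (fun _ => c) = fun _ => 0 := by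
  funext z; simp [dMom]

theorem dPos_comp {f : ℝ → ℝ} {g : ℝ × ℝ → ℝ} {z : ℝ × ℝ} (hf : DifferentiableAt ℝ f (g z))
    (hg : DifferentiableAt ℝ g z) : dPos (fun w => f (g w)) z = deriv f (g z) * dPos g z := by
  have := (hf.hasDerivAt.comp_hasFDerivAt z hg.hasFDerivAt).fderiv
  simp only [Function.comp_def] at this
  simp [dPos, this]

theorem dMom_comp {f : ℝ → ℝ} {g : ℝ × ℝ → ℝ} {z : ℝ × ℝ} (hf : DifferentiableAt ℝ f (g z))
    (hg : DifferentiableAt ℝ g z) : dMom (fun w => f (g w)) z = deriv f (g z) * dMom g z := by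
  have := (hf.hasDerivAt.comp_hasFDerivAt z hg.hasFDerivAt).fderiv
  simp only [Function.comp_def] at this
  simp [dMom, this]

theorem dPos_fst (z : ℝ × ℝ) : dPos (fun w => w.1) z = 1 := by
  simp [dPos, fderiv_fst]

theorem dMom_fst (z : ℝ × ℝ) : dMom (fun w => w.1) z = 0 := by
  simp [dMom, fderiv_fst]

theorem dPos_snd (z : ℝ × ℝ) : dPos (fun w => w.2) z = 0 := by
  simp [dPos, fderiv_snd]

theorem dMom_snd (z : ℝ × ℝ) : dMom (fun w => w.2) z = 1 := by
  simp [dMom, fderiv_snd]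

theorem dPos_dMom_comm {U : Set (ℝ × ℝ)} (hU : IsOpen U) {g : ℝ × ℝ → ℝ}
    (hg : ContDiffOn ℝ (⊤ : ℕ∞) g U) {z : ℝ × ℝ} (hz : z ∈ U) :
    dPos (dMom g) z = dMom (dPos g) z := by
  have h1 := hg.contDiffAt (hU.mem_nhds hz)
  have h2 := h1.isSymmSndFDerivAt (by
    rw [minSmoothness_of_isRCLikeNormedField]; exact WithTop.coe_le_coe.2 (le_top : (2 : ℕ∞) ≤ ⊤))
  have h3 : DifferentiableAt ℝ (fderiv ℝ g) z :=
    (h1.fderiv_right (m := (⊤ : ℕ∞)) (by simp)).differentiableAt (by simp)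
  have e : ∀ v w : ℝ × ℝ, fderiv ℝ (fun y => fderiv ℝ g y v) z w
      = fderiv ℝ (fderiv ℝ g) z w v := fun v w => by
    rw [fderiv_clm_apply h3 (differentiableAt_const v)]; simp
  change fderiv ℝ (fun y => fderiv ℝ g y (0, 1)) z (1, 0)
    = fderiv ℝ (fun y => fderiv ℝ g y (1, 0)) z (0, 1)
  rw [e, e]
  exact h2 _ _

/-- Symbol estimates of order `(a,b)` on `U` for the derivatives of total order at most `k`. -/
def SymB (l : ℝ) (U : Set (ℝ × ℝ)) : ℕ → ℝ → ℝ → (ℝ × ℝ → ℝ) → Prop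
  | 0, a, b, g => ∃ C, ∀ z ∈ U, |g z| ≤ C * wt l a b z
  | k + 1, a, b, g => (∃ C, ∀ z ∈ U, |g z| ≤ C * wt l a b z) ∧
      SymB l U k a (b - 1) (dPos g) ∧ SymB l U k (a - l) b (dMom g)

theorem SymB.bound {l : ℝ} {U : Set (ℝ × ℝ)} {k : ℕ} {a b : ℝ} {g : ℝ × ℝ → ℝ}
    (h : SymB l U k a b g) : ∃ C, ∀ z ∈ U, |g z| ≤ C * wt l a b z := by
  cases k with
  | zero => exact h
  | succ k => exact h.1

theorem SymB.pred {l : ℝ} {U : Set (ℝ × ℝ)} {k : ℕ} {a b : ℝ} {g : ℝ × ℝ → ℝ}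
    (h : SymB l U (k + 1) a b g) : SymB l U k a b g := by
  induction k generalizing a b g with
  | zero => exact h.1
  | succ k ih => exact ⟨h.1, ih h.2.1, ih h.2.2⟩

theorem SymB.congr {l : ℝ} {U : Set (ℝ × ℝ)} (hU : IsOpen U) {k : ℕ} {a b : ℝ}
    {g h : ℝ × ℝ → ℝ} (hg : SymB l U k a b g) (e : Set.EqOn g h U) : SymB l U k a b h := by
  induction k generalizing a b g h with
  | zero =>
    obtain ⟨C, hC⟩ := hg
    exact ⟨C, fun z hz => e hz ▸ hC z hz⟩
  | succ k ih =>
    obtain ⟨⟨C, hC⟩, h1, h2⟩ := hg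
    exact ⟨⟨C, fun z hz => e hz ▸ hC z hz⟩, ih h1 (dPos_congr hU e), ih h2 (dMom_congr hU e)⟩

theorem SymB.weaken {l : ℝ} (hl : 0 < l) {U : Set (ℝ × ℝ)} {k : ℕ} {a b a' b' : ℝ}
    {g : ℝ × ℝ → ℝ} (hg : SymB l U k a b g) (h1 : a ≤ a') (h2 : a + b ≤ a' + b') :
    SymB l U k a' b' g := by
  have key : ∀ {a b a' b' : ℝ} {g : ℝ × ℝ → ℝ}, (∃ C, ∀ z ∈ U, |g z| ≤ C * wt l a b z) →
      a ≤ a' → a + b ≤ a' + b' → ∃ C, ∀ z ∈ U, |g z| ≤ C * wt l a' b' z := by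
    rintro a b a' b' g ⟨C, hC⟩ h1 h2
    obtain ⟨C', hC', h⟩ := wt_le hl h1 h2
    refine ⟨|C| * C', fun z hz => (hC z hz).trans ?_⟩
    calc C * wt l a b z ≤ |C| * (C' * wt l a' b' z) :=
          mul_le_mul (le_abs_self C) (h z) (wt_pos hl _ _ _).le (abs_nonneg C)
      _ = _ := by ring
  induction k generalizing a b a' b' g with
  | zero => exact key hg h1 h2
  | succ k ih =>
    exact ⟨key hg.1 h1 h2, ih hg.2.1 h1 (by linarith), ih hg.2.2 (by linarith) (by linarith)⟩

theorem SymB.add {l : ℝ} {U : Set (ℝ × ℝ)} (hU : IsOpen U) {k : ℕ} {a b : ℝ}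
    {g h : ℝ × ℝ → ℝ} (sg : ContDiffOn ℝ (⊤ : ℕ∞) g U) (sh : ContDiffOn ℝ (⊤ : ℕ∞) h U)
    (hg : SymB l U k a b g) (hh : SymB l U k a b h) :
    SymB l U k a b (fun z => g z + h z) := by
  have key : ∀ {a b : ℝ} {g h : ℝ × ℝ → ℝ}, (∃ C, ∀ z ∈ U, |g z| ≤ C * wt l a b z) →
      (∃ C, ∀ z ∈ U, |h z| ≤ C * wt l a b z) →
      ∃ C, ∀ z ∈ U, |g z + h z| ≤ C * wt l a b z := by
    rintro a b g h ⟨C, hC⟩ ⟨C', hC'⟩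
    refine ⟨C + C', fun z hz => (abs_add_le _ _).trans ?_⟩
    rw [add_mul]
    exact add_le_add (hC z hz) (hC' z hz)
  induction k generalizing a b g h with
  | zero => exact key hg hh
  | succ k ih =>
    refine ⟨key hg.1 hh.1, ?_, ?_⟩
    · exact (ih (dPos_smooth hU sg) (dPos_smooth hU sh) hg.2.1 hh.2.1).congr hU fun z hz =>
        (dPos_add (smooth_differentiableAt hU sg hz) (smooth_differentiableAt hU sh hz)).symm
    · exact (ih (dMom_smooth hU sg) (dMom_smooth hU sh) hg.2.2 hh.2.2).congr hU fun z hz =>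
        (dMom_add (smooth_differentiableAt hU sg hz) (smooth_differentiableAt hU sh hz)).symm

theorem SymB.mul {l : ℝ} (hl : 0 < l) {U : Set (ℝ × ℝ)} (hU : IsOpen U) {k : ℕ}
    {a b a' b' : ℝ} {g h : ℝ × ℝ → ℝ} (sg : ContDiffOn ℝ (⊤ : ℕ∞) g U)
    (sh : ContDiffOn ℝ (⊤ : ℕ∞) h U) (hg : SymB l U k a b g) (hh : SymB l U k a' b' h) :
    SymB l U k (a + a') (b + b') (fun z => g z * h z) := by
  have key : ∀ {a b a' b' : ℝ} {g h : ℝ × ℝ → ℝ}, (∃ C, ∀ z ∈ U, |g z| ≤ C * wt l a b z) →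
      (∃ C, ∀ z ∈ U, |h z| ≤ C * wt l a' b' z) →
      ∃ C, ∀ z ∈ U, |g z * h z| ≤ C * wt l (a + a') (b + b') z := by
    rintro a b a' b' g h ⟨C, hC⟩ ⟨C', hC'⟩
    refine ⟨C * C', fun z hz => ?_⟩
    rw [abs_mul, ← wt_mul hl]
    calc |g z| * |h z| ≤ (C * wt l a b z) * (C' * wt l a' b' z) :=
          mul_le_mul (hC z hz) (hC' z hz) (abs_nonneg _) ((abs_nonneg _).trans (hC z hz))
      _ = _ := by ring
  induction k generalizing a b a' b' g h with
  | zero => exact key hg hh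
  | succ k ih =>
    refine ⟨key hg.1 hh.1, ?_, ?_⟩
    · have h1 := ih sg (dPos_smooth hU sh) hg.pred hh.2.1
      have h2 := ih (dPos_smooth hU sg) sh hg.2.1 hh.pred
      rw [show b + (b' - 1) = b + b' - 1 by ring] at h1
      rw [show b - 1 + b' = b + b' - 1 by ring] at h2
      exact (h1.add hU (sg.mul (dPos_smooth hU sh)) ((dPos_smooth hU sg).mul sh) h2).congr hU
        fun z hz => (dPos_mul (smooth_differentiableAt hU sg hz)
          (smooth_differentiableAt hU sh hz)).symm
    · have h1 := ih sg (dMom_smooth hU sh) hg.pred hh.2.2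
      have h2 := ih (dMom_smooth hU sg) sh hg.2.2 hh.pred
      rw [show a + (a' - l) = a + a' - l by ring] at h1
      rw [show a - l + a' = a + a' - l by ring] at h2
      exact (h1.add hU (sg.mul (dMom_smooth hU sh)) ((dMom_smooth hU sg).mul sh) h2).congr hU
        fun z hz => (dMom_mul (smooth_differentiableAt hU sg hz)
          (smooth_differentiableAt hU sh hz)).symm

theorem SymB.zero {l : ℝ} {U : Set (ℝ × ℝ)} {k : ℕ} {a b : ℝ} :
    SymB l U k a b (fun _ => 0) := by
  have key : ∀ {a b : ℝ}, ∃ C, ∀ z ∈ U, |(0 : ℝ)| ≤ C * wt l a b z := ⟨0, by simp⟩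
  induction k generalizing a b with
  | zero => exact key
  | succ k ih => exact ⟨key, by rw [dPos_const]; exact ih, by rw [dMom_const]; exact ih⟩

/-- The symbol class `S^{a,b}` on the open set `U`. -/
structure Symb (l : ℝ) (U : Set (ℝ × ℝ)) (a b : ℝ) (g : ℝ × ℝ → ℝ) : Prop where
  smooth : ContDiffOn ℝ (⊤ : ℕ∞) g U
  bound : ∀ k, SymB l U k a b g

namespace Symb

variable {l : ℝ} {U : Set (ℝ × ℝ)} {a b a' b' : ℝ} {g h : ℝ × ℝ → ℝ}

theorem congr (hU : IsOpen U) (hg : Symb l U a b g) (e : Set.EqOn g h U) : Symb l U a b h :=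
  ⟨hg.smooth.congr fun _ hz => (e hz).symm, fun k => (hg.bound k).congr hU e⟩

theorem weaken (hl : 0 < l) (hg : Symb l U a b g) (h1 : a ≤ a') (h2 : a + b ≤ a' + b') :
    Symb l U a' b' g :=
  ⟨hg.smooth, fun k => (hg.bound k).weaken hl h1 h2⟩

theorem add (hU : IsOpen U) (hg : Symb l U a b g) (hh : Symb l U a b h) :
    Symb l U a b (fun z => g z + h z) :=
  ⟨hg.smooth.add hh.smooth, fun k => (hg.bound k).add hU hg.smooth hh.smooth (hh.bound k)⟩

theorem mul (hl : 0 < l) (hU : IsOpen U) (hg : Symb l U a b g) (hh : Symb l U a' b' h) :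
    Symb l U (a + a') (b + b') (fun z => g z * h z) :=
  ⟨hg.smooth.mul hh.smooth, fun k => (hg.bound k).mul hl hU hg.smooth hh.smooth (hh.bound k)⟩

theorem derivPos (hU : IsOpen U) (hg : Symb l U a b g) : Symb l U a (b - 1) (dPos g) :=
  ⟨dPos_smooth hU hg.smooth, fun k => (hg.bound (k + 1)).2.1⟩

theorem derivMom (hU : IsOpen U) (hg : Symb l U a b g) : Symb l U (a - l) b (dMom g) :=
  ⟨dMom_smooth hU hg.smooth, fun k => (hg.bound (k + 1)).2.2⟩

theorem const (c : ℝ) : Symb l U 0 0 (fun _ => c) := by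
  have key : ∃ C, ∀ z ∈ U, |c| ≤ C * wt l 0 0 z := ⟨|c|, by simp [wt]⟩
  refine ⟨contDiffOn_const, fun k => ?_⟩
  cases k with
  | zero => exact key
  | succ k =>
    exact ⟨key, by rw [dPos_const]; exact SymB.zero, by rw [dMom_const]; exact SymB.zero⟩

theorem const_mul (hl : 0 < l) (hU : IsOpen U) (c : ℝ) (hg : Symb l U a b g) :
    Symb l U a b (fun z => c * g z) := by
  simpa using (const (l := l) (U := U) c).mul hl hU hg

theorem sub (hl : 0 < l) (hU : IsOpen U) (hg : Symb l U a b g) (hh : Symb l U a b h) :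
    Symb l U a b (fun z => g z - h z) :=
  (hg.add hU (hh.const_mul hl hU (-1))).congr hU fun z _ => by ring

theorem inv (hl : 0 < l) (hU : IsOpen U) (hg : Symb l U a b g) {c : ℝ} (hc : 0 < c)
    (hgc : ∀ z ∈ U, c * wt l a b z ≤ g z) : Symb l U (-a) (-b) (fun z => (g z)⁻¹) := by
  have hpos : ∀ z ∈ U, 0 < g z := fun z hz => (mul_pos hc (wt_pos hl a b z)).trans_le (hgc z hz)
  have hs : ContDiffOn ℝ (⊤ : ℕ∞) (fun z => (g z)⁻¹) U :=
    hg.smooth.inv fun z hz => (hpos z hz).ne'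
  have key : ∃ C, ∀ z ∈ U, |(g z)⁻¹| ≤ C * wt l (-a) (-b) z := by
    refine ⟨c⁻¹, fun z hz => ?_⟩
    have h1 := wt_mul hl a b (-a) (-b) z
    have h2 : wt l (a + -a) (b + -b) z = 1 := by simp [wt]
    rw [h2] at h1
    rw [abs_of_pos (inv_pos.2 (hpos z hz)), eq_inv_of_mul_eq_one_right h1, ← mul_inv]
    exact inv_anti₀ (mul_pos hc (wt_pos hl a b z)) (hgc z hz)
  refine ⟨hs, fun k => ?_⟩
  induction k with
  | zero => exact key
  | succ k ih =>
    have hder : ∀ z ∈ U, HasDerivAt (fun t : ℝ => t⁻¹) (-((g z) ^ 2)⁻¹) (g z) := fun z hz =>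
      hasDerivAt_inv (hpos z hz).ne'
    have hm := hs.mul hs
    refine ⟨key, ?_, ?_⟩
    · have h1 := (ih.mul hl hU hs hs ih).mul hl hU hm
        ((hg.derivPos hU).const_mul hl hU (-1)).smooth (((hg.derivPos hU).const_mul hl hU (-1)).bound k)
      rw [show -a + -a + a = -a by ring, show -b + -b + (b - 1) = -b - 1 by ring] at h1
      refine h1.congr hU fun z hz => ?_
      rw [dPos_comp (hder z hz).differentiableAt (smooth_differentiableAt hU hg.smooth hz),
        (hder z hz).deriv]
      ring
    · have h1 := (ih.mul hl hU hs hs ih).mul hl hU hm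
        ((hg.derivMom hU).const_mul hl hU (-1)).smooth (((hg.derivMom hU).const_mul hl hU (-1)).bound k)
      rw [show -a + -a + (a - l) = -a - l by ring, show -b + -b + b = -b by ring] at h1
      refine h1.congr hU fun z hz => ?_
      rw [dMom_comp (hder z hz).differentiableAt (smooth_differentiableAt hU hg.smooth hz),
        (hder z hz).deriv]
      ring

/-- Functions of the position variable with the natural decay are symbols. -/
theorem of_pos {f : ℝ → ℝ} (hf : ContDiff ℝ (⊤ : ℕ∞) f)
    (hb : ∀ k : ℕ, ∃ C, ∀ x, |iteratedDeriv k f x| ≤ C * jap x ^ (b - (k : ℝ))) :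
    Symb l U 0 b (fun z => f z.1) := by
  have hd : ∀ j : ℕ, Differentiable ℝ (iteratedDeriv j f) := fun j =>
    hf.differentiable_iteratedDeriv j (by exact_mod_cast ENat.natCast_lt_top j)
  have key : ∀ k j : ℕ, SymB l U k 0 (b - j) (fun z => iteratedDeriv j f z.1) := by
    intro k
    have key0 : ∀ j : ℕ, ∃ C, ∀ z ∈ U, |iteratedDeriv j f z.1| ≤ C * wt l 0 (b - j) z := fun j => by
      obtain ⟨C, hC⟩ := hb j
      exact ⟨C, fun z _ => by simpa [wt] using hC z.1⟩
    induction k with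
    | zero => exact key0
    | succ k ih =>
      intro j
      refine ⟨key0 j, ?_, ?_⟩
      · have h1 := ih (j + 1)
        have h2 : dPos (fun z => iteratedDeriv j f z.1)
            = fun z => iteratedDeriv (j + 1) f z.1 := by
          funext z
          rw [dPos_comp (hd j _) differentiableAt_fst, dPos_fst, iteratedDeriv_succ, mul_one]
        rw [h2, sub_sub]
        exact_mod_cast h1
      · have h2 : dMom (fun z => iteratedDeriv j f z.1) = fun z => 0 := by
          funext z
          rw [dMom_comp (hd j _) differentiableAt_fst, dMom_fst, mul_zero]
        rw [h2]
        exact SymB.zero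
  refine ⟨(hf.comp contDiff_fst).contDiffOn, fun k => ?_⟩
  simpa using key k 0

theorem pos : Symb l U 0 1 (fun z => z.1) := by
  have key : ∃ C, ∀ z ∈ U, |z.1| ≤ C * wt l 0 1 z :=
    ⟨1, fun z _ => by simpa [wt] using abs_le_jap z.1⟩
  refine ⟨contDiffOn_fst, fun k => ?_⟩
  cases k with
  | zero => exact key
  | succ k =>
    refine ⟨key, ?_, ?_⟩
    · rw [show dPos (fun z => z.1) = fun _ => 1 from funext dPos_fst, sub_self]
      exact (const 1).bound k
    · rw [show dMom (fun z => z.1) = fun _ => 0 from funext dMom_fst]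
      exact SymB.zero

theorem mom (hl : 0 < l) : Symb l U l 0 (fun z => z.2) := by
  have key : ∃ C, ∀ z ∈ U, |z.2| ≤ C * wt l l 0 z :=
    ⟨1, fun z _ => by simpa [wt] using abs_le_lam_rpow hl z.1 z.2⟩
  refine ⟨contDiffOn_snd, fun k => ?_⟩
  cases k with
  | zero => exact key
  | succ k =>
    refine ⟨key, ?_, ?_⟩
    · rw [show dPos (fun z => z.2) = fun _ => 0 from funext dPos_snd]
      exact SymB.zero
    · rw [show dMom (fun z => z.2) = fun _ => 1 from funext dMom_snd, sub_self]
      exact (const 1).bound k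

/-- Composition of a one-variable function with a symbol. -/
theorem comp (hl : 0 < l) (hU : IsOpen U) {d s : ℝ} (hh : Symb l U d 0 h) {O : Set ℝ}
    (hO : IsOpen O) (hUO : ∀ z ∈ U, h z ∈ O) {f : ℝ → ℝ} (hf : ContDiffOn ℝ (⊤ : ℕ∞) f O)
    (hb : ∀ k : ℕ, ∃ C, ∀ z ∈ U, |iteratedDeriv k f (h z)| ≤ C * wt l (s - k * d) 0 z) :
    Symb l U s 0 (fun z => f (h z)) := by
  have hs : ∀ j : ℕ, ContDiffOn ℝ (⊤ : ℕ∞) (iteratedDeriv j f) O := by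
    intro j
    induction j with
    | zero => simpa using hf
    | succ j ih =>
      rw [iteratedDeriv_succ]
      exact ih.deriv_of_isOpen hO (by simp)
  have hd : ∀ j : ℕ, ∀ z ∈ U, DifferentiableAt ℝ (iteratedDeriv j f) (h z) := fun j z hz =>
    ((hs j).contDiffAt (hO.mem_nhds (hUO z hz))).differentiableAt (by simp)
  have hsc : ∀ j : ℕ, ContDiffOn ℝ (⊤ : ℕ∞) (fun z => iteratedDeriv j f (h z)) U := fun j =>
    (hs j).comp hh.smooth hUO
  have key : ∀ k j : ℕ, SymB l U k (s - j * d) 0 (fun z => iteratedDeriv j f (h z)) := by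
    intro k
    induction k with
    | zero => exact hb
    | succ k ih =>
      intro j
      refine ⟨hb j, ?_, ?_⟩
      · have h1 := (ih (j + 1)).mul hl hU (hsc _) (dPos_smooth hU hh.smooth)
          ((hh.derivPos hU).bound k)
        rw [show s - ((j + 1 : ℕ) : ℝ) * d + d = s - j * d by push_cast; ring, zero_add] at h1
        rw [zero_sub] at h1 ⊢
        refine h1.congr hU fun z hz => ?_
        rw [dPos_comp (hd j z hz) (smooth_differentiableAt hU hh.smooth hz), iteratedDeriv_succ]
      · have h1 := (ih (j + 1)).mul hl hU (hsc _) (dMom_smooth hU hh.smooth)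
          ((hh.derivMom hU).bound k)
        rw [show s - ((j + 1 : ℕ) : ℝ) * d + (d - l) = s - j * d - l by push_cast; ring,
          zero_add] at h1
        refine h1.congr hU fun z hz => ?_
        rw [dMom_comp (hd j z hz) (smooth_differentiableAt hU hh.smooth hz), iteratedDeriv_succ]
  refine ⟨hf.comp hh.smooth hUO, fun k => ?_⟩
  simpa using key k 0

end Symb

theorem SymB.mono {l : ℝ} {U U' : Set (ℝ × ℝ)} (hUU : U' ⊆ U) {k : ℕ} {a b : ℝ}
    {g : ℝ × ℝ → ℝ} (h : SymB l U k a b g) : SymB l U' k a b g := by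
  induction k generalizing a b g with
  | zero => exact h.imp fun C hC z hz => hC z (hUU hz)
  | succ k ih => exact ⟨h.1.imp fun C hC z hz => hC z (hUU hz), ih h.2.1, ih h.2.2⟩

theorem Symb.mono {l : ℝ} {U U' : Set (ℝ × ℝ)} (hUU : U' ⊆ U) {a b : ℝ}
    {g : ℝ × ℝ → ℝ} (h : Symb l U a b g) : Symb l U' a b g :=
  ⟨h.smooth.mono hUU, fun k => (h.bound k).mono hUU⟩

theorem dPos_iterate_smooth {g : ℝ × ℝ → ℝ} (hg : ContDiff ℝ (⊤ : ℕ∞) g) (j : ℕ) :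
    ContDiff ℝ (⊤ : ℕ∞) (dPos^[j] g) := by
  induction j with
  | zero => exact hg
  | succ j ih =>
    rw [Function.iterate_succ_apply', ← contDiffOn_univ]
    exact dPos_smooth isOpen_univ ih.contDiffOn

theorem dMom_iterate_smooth {g : ℝ × ℝ → ℝ} (hg : ContDiff ℝ (⊤ : ℕ∞) g) (j : ℕ) :
    ContDiff ℝ (⊤ : ℕ∞) (dMom^[j] g) := by
  induction j with
  | zero => exact hg
  | succ j ih =>
    rw [Function.iterate_succ_apply', ← contDiffOn_univ]
    exact dMom_smooth isOpen_univ ih.contDiffOn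

theorem deriv_pos_eq {g : ℝ × ℝ → ℝ} {x ξ : ℝ} (hg : DifferentiableAt ℝ g (x, ξ)) :
    HasDerivAt (fun x' => g (x', ξ)) (dPos g (x, ξ)) x :=
  hg.hasFDerivAt.comp_hasDerivAt x ((hasDerivAt_id x).prodMk (hasDerivAt_const x ξ))

theorem deriv_mom_eq {g : ℝ × ℝ → ℝ} {x ξ : ℝ} (hg : DifferentiableAt ℝ g (x, ξ)) :
    HasDerivAt (fun ξ' => g (x, ξ')) (dMom g (x, ξ)) ξ :=
  hg.hasFDerivAt.comp_hasDerivAt ξ ((hasDerivAt_const ξ x).prodMk (hasDerivAt_id ξ))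

theorem iteratedDeriv_pos_eq {g : ℝ × ℝ → ℝ} (hg : ContDiff ℝ (⊤ : ℕ∞) g) (j : ℕ) (x ξ : ℝ) :
    iteratedDeriv j (fun x' => g (x', ξ)) x = (dPos^[j] g) (x, ξ) := by
  induction j generalizing x with
  | zero => simp
  | succ j ih =>
    rw [iteratedDeriv_succ, funext ih, Function.iterate_succ_apply']
    exact (deriv_pos_eq ((dPos_iterate_smooth hg j).differentiable (by simp) _)).deriv

theorem iteratedDeriv_mom_eq {g : ℝ × ℝ → ℝ} (hg : ContDiff ℝ (⊤ : ℕ∞) g) (j : ℕ) (x ξ : ℝ) :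
    iteratedDeriv j (fun ξ' => g (x, ξ')) ξ = (dMom^[j] g) (x, ξ) := by
  induction j generalizing ξ with
  | zero => simp
  | succ j ih =>
    rw [iteratedDeriv_succ, funext ih, Function.iterate_succ_apply']
    exact (deriv_mom_eq ((dMom_iterate_smooth hg j).differentiable (by simp) _)).deriv

theorem iteratedDeriv_mixed_eq {g : ℝ × ℝ → ℝ} (hg : ContDiff ℝ (⊤ : ℕ∞) g) (i j : ℕ) (x ξ : ℝ) :
    iteratedDeriv i (fun ξ' => iteratedDeriv j (fun x' => g (x', ξ')) x) ξ
      = (dMom^[i] (dPos^[j] g)) (x, ξ) := by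
  simp_rw [iteratedDeriv_pos_eq hg]
  exact iteratedDeriv_mom_eq (dPos_iterate_smooth hg j) i x ξ

theorem dPos_dMom_iterate {g : ℝ × ℝ → ℝ} (hg : ContDiff ℝ (⊤ : ℕ∞) g) (i : ℕ) :
    dPos (dMom^[i] g) = dMom^[i] (dPos g) := by
  induction i with
  | zero => rfl
  | succ i ih =>
    rw [Function.iterate_succ_apply', Function.iterate_succ_apply', ← ih]
    funext z
    exact dPos_dMom_comm isOpen_univ (dMom_iterate_smooth hg i).contDiffOn (Set.mem_univ z)

theorem Symb.of_isSymbol {l m₁ m₂ : ℝ} {p : ℝ → ℝ → ℝ} (hp : IsSymbol l m₁ m₂ p) :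
    Symb l Set.univ m₁ m₂ (fun z => p z.1 z.2) := by
  obtain ⟨hs, hb⟩ := hp
  have key : ∀ k i j : ℕ, SymB l Set.univ k (m₁ - i * l) (m₂ - j)
      (dMom^[i] (dPos^[j] (fun z => p z.1 z.2))) := by
    have key0 : ∀ i j : ℕ, ∃ C, ∀ z ∈ Set.univ, |(dMom^[i] (dPos^[j] (fun z => p z.1 z.2))) z|
        ≤ C * wt l (m₁ - i * l) (m₂ - j) z := fun i j => by
      obtain ⟨C, hC⟩ := hb i j
      refine ⟨C, fun z _ => ?_⟩
      rw [← iteratedDeriv_mixed_eq hs, wt, ← mul_assoc]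
      exact hC z.1 z.2
    intro k
    induction k with
    | zero => exact key0
    | succ k ih =>
      intro i j
      refine ⟨key0 i j, ?_, ?_⟩
      · rw [dPos_dMom_iterate (dPos_iterate_smooth hs j), ← Function.iterate_succ_apply' dPos,
          sub_sub]
        exact_mod_cast ih i (j + 1)
      · rw [← Function.iterate_succ_apply' dMom,
          show m₁ - i * l - l = m₁ - ((i + 1 : ℕ) : ℝ) * l by push_cast; ring]
        exact ih (i + 1) j
  refine ⟨hs.contDiffOn, fun k => ?_⟩
  simpa using key k 0 0

theorem SymB.mixed {l : ℝ} {U : Set (ℝ × ℝ)} {a b : ℝ} {g : ℝ × ℝ → ℝ} (i j k : ℕ)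
    (h : SymB l U (i + j + k) a b g) :
    SymB l U k (a - i * l) (b - j) (dMom^[i] (dPos^[j] g)) := by
  induction j generalizing b g with
  | zero =>
    simp only [Nat.cast_zero, sub_zero, Function.iterate_zero, id]
    induction i generalizing a g with
    | zero => simpa using h
    | succ i ih =>
      rw [show i + 1 + 0 + k = (i + 0 + k) + 1 by ring] at h
      have := ih h.2.2
      rw [Function.iterate_succ_apply,
        show a - ((i + 1 : ℕ) : ℝ) * l = a - l - i * l by push_cast; ring]
      exact this
  | succ j ih =>
    rw [show i + (j + 1) + k = (i + j + k) + 1 by ring] at h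
    have := ih h.2.1
    rw [Function.iterate_succ_apply, show b - ((j + 1 : ℕ) : ℝ) = b - 1 - j by push_cast; ring]
    exact this

theorem Symb.isSymbol {l a b : ℝ} {g : ℝ × ℝ → ℝ} (hg : Symb l Set.univ a b g) :
    IsSymbol l a b (fun x ξ => g (x, ξ)) := by
  have hs : ContDiff ℝ (⊤ : ℕ∞) g := contDiffOn_univ.1 hg.smooth
  refine ⟨hs, fun i j => ?_⟩
  obtain ⟨C, hC⟩ := (hg.bound (i + j + 0)).mixed i j 0
  refine ⟨C, fun x ξ => ?_⟩
  rw [iteratedDeriv_mixed_eq hs, mul_assoc]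
  exact hC (x, ξ) (Set.mem_univ _)

/-- A symbol on `U` which vanishes off a set whose closure lies in `U` is, extended by zero, a
symbol on the plane. -/
theorem Symb.extend {l a b : ℝ} (hl : 0 < l) {U W : Set (ℝ × ℝ)} (hU : IsOpen U) (hW : IsOpen W)
    (hUW : U ∪ W = Set.univ) {g : ℝ × ℝ → ℝ} (hg : Symb l U a b g) (h0 : ∀ z ∈ W, g z = 0) :
    Symb l Set.univ a b g := by
  have e : Set.EqOn g (fun _ => 0) W := h0
  refine ⟨?_, fun k => ?_⟩
  · rw [← hUW]
    exact hg.smooth.union_of_isOpen (contDiffOn_const.congr e) hU hW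
  · have hb := hg.bound k
    have hb' : SymB l W k a b g := SymB.zero.congr hW e.symm
    clear hg h0 e
    have key : ∀ {a b : ℝ} {g : ℝ × ℝ → ℝ}, (∃ C, ∀ z ∈ U, |g z| ≤ C * wt l a b z) →
        (∃ C, ∀ z ∈ W, |g z| ≤ C * wt l a b z) →
        ∃ C, ∀ z ∈ Set.univ, |g z| ≤ C * wt l a b z := by
      rintro a b g ⟨C, hC⟩ ⟨C', hC'⟩
      refine ⟨max C C', fun z hz => ?_⟩
      rw [← hUW] at hz
      have hw := (wt_pos hl a b z).le
      rcases hz with hz | hz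
      · exact (hC z hz).trans (mul_le_mul_of_nonneg_right (le_max_left _ _) hw)
      · exact (hC' z hz).trans (mul_le_mul_of_nonneg_right (le_max_right _ _) hw)
    induction k generalizing a b g with
    | zero => exact key hb hb'
    | succ k ih => exact ⟨key hb.1 hb'.1, ih hb.2.1 hb'.2.1, ih hb.2.2 hb'.2.2⟩

/-- The classical Hamiltonian `ξ² + V(x)`. -/
def energy (V : ℝ → ℝ) (z : ℝ × ℝ) : ℝ := z.2 ^ 2 + V z.1

namespace GoodPotential

variable {l : ℝ} {V : ℝ → ℝ}

theorem hasDerivAt (hV : GoodPotential l V) (x : ℝ) : HasDerivAt V (deriv V x) x :=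
  (hV.smooth.differentiable (by simp) x).hasDerivAt

theorem smooth_deriv (hV : GoodPotential l V) : ContDiff ℝ (⊤ : ℕ∞) (deriv V) :=
  (contDiff_infty_iff_deriv.1 hV.smooth).2

theorem deriv_neg (hV : GoodPotential l V) (x : ℝ) : deriv V (-x) = -deriv V x := by
  have h := deriv_comp_neg V x
  rw [funext hV.even] at h
  linarith

theorem value_far (hl : 1 < l) (hV : GoodPotential l V) :
    ∃ R, ∀ x, R ≤ |x| → |x| ^ (2 * l) / 4 ≤ V x - V 0 := by
  obtain ⟨Vh, -, hb⟩ := hV.expansion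
  obtain ⟨C, R, h⟩ := hb 0 0
  refine ⟨max R (2 * |C| + 4 * |V 0| + 1), fun x hx => ?_⟩
  have h1 := h x ((le_max_left _ _).trans hx)
  have h2 := (le_max_right _ _).trans hx
  have hC := abs_nonneg C
  have hV0 := abs_nonneg (V 0)
  have hx1 : 1 ≤ |x| := by linarith
  simp only [iteratedDeriv_zero, Nat.cast_zero, zero_add, mul_one, sub_zero,
    Finset.sum_empty, show Finset.Icc 1 0 = ∅ from rfl] at h1
  have e : |x| ^ (2 * l) = |x| ^ (2 * l - 2) * |x| ^ 2 := by
    rw [← Real.rpow_natCast, ← Real.rpow_add (by linarith)]; norm_num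
  have hp : 1 ≤ |x| ^ (2 * l - 2) := Real.one_le_rpow hx1 (by linarith)
  have h3 : |x| ≤ |x| ^ 2 := by nlinarith
  have h4 : C * |x| ^ (2 * l - 2) ≤ |x| ^ (2 * l) / 2 := by
    rw [e]; nlinarith [le_abs_self C]
  have h5 : 4 * |V 0| ≤ |x| ^ (2 * l) := by
    rw [e]; nlinarith
  have := (abs_le.1 h1).1
  linarith [le_abs_self (V 0)]

theorem deriv_far_pos (hl : 1 < l) (hV : GoodPotential l V) :
    ∃ R, 0 < R ∧ ∀ x, R ≤ x → x ^ (2 * l) ≤ x * deriv V x := by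
  obtain ⟨Vh, -, hb⟩ := hV.expansion
  obtain ⟨C, R, h⟩ := hb 0 1
  refine ⟨max R (|C| + 1), lt_max_of_lt_right (by positivity), fun x hx => ?_⟩
  have h2 := (le_max_right _ _).trans hx
  have hC := abs_nonneg C
  have hx1 : 1 ≤ x := by linarith
  have hx0 : 0 < x := by linarith
  have h1 := h x (((le_max_left _ _).trans hx).trans (le_abs_self x))
  have hd : HasDerivAt (fun y => V y - |y| ^ (2 * l)) (deriv V x - 2 * l * x ^ (2 * l - 1)) x := by
    refine (hV.hasDerivAt x).sub ((Real.hasDerivAt_rpow_const (Or.inl hx0.ne')).congr_of_eventuallyEq ?_)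
    filter_upwards [lt_mem_nhds hx0] with y hy
    rw [abs_of_pos hy]
  simp only [iteratedDeriv_one, Nat.cast_zero, zero_add, mul_one, sub_zero,
    Finset.sum_empty, show Finset.Icc 1 0 = ∅ from rfl, hd.deriv, Nat.cast_one,
    abs_of_pos hx0] at h1
  have e : x ^ (2 * l) = x ^ (2 * l - 2 - 1) * x ^ 3 := by
    rw [← Real.rpow_natCast, ← Real.rpow_add hx0]; congr 1; push_cast; ring
  have e' : x ^ (2 * l) = x ^ (2 * l - 1) * x := by
    rw [← Real.rpow_add_one hx0.ne']; norm_num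
  have hp : 0 < x ^ (2 * l - 2 - 1) := Real.rpow_pos_of_pos hx0 _
  have h3 : x * (C * x ^ (2 * l - 2 - 1)) ≤ x ^ (2 * l) := by
    have : C ≤ x ^ 2 := by nlinarith [le_abs_self C]
    rw [e]; nlinarith [mul_nonneg hp.le hx0.le]
  have h4 := (abs_le.1 h1).1
  have h6 : 0 < x ^ (2 * l) := Real.rpow_pos_of_pos hx0 _
  have h5 : x * (2 * l * x ^ (2 * l - 1)) = 2 * l * x ^ (2 * l) := by rw [e']; ring
  nlinarith

theorem deriv_pos (hl : 1 < l) (hV : GoodPotential l V) {x : ℝ} (hx : 0 < x) : 0 < deriv V x := by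
  obtain ⟨R, hR, h⟩ := hV.deriv_far_pos hl
  have hRp : 0 < deriv V R := by
    have := h R le_rfl
    have h6 : 0 < R ^ (2 * l) := Real.rpow_pos_of_pos hR _
    by_contra hn
    nlinarith
  by_contra hn
  obtain ⟨y, hy, hy0⟩ := isPreconnected_Ioi.intermediate_value (s := Set.Ioi (0:ℝ)) hx hR
    hV.smooth_deriv.continuous.continuousOn ⟨not_lt.1 hn, hRp.le⟩
  exact hV.deriv_ne y (ne_of_gt hy) hy0

theorem mul_deriv_pos (hl : 1 < l) (hV : GoodPotential l V) {x : ℝ} (hx : x ≠ 0) :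
    0 < x * deriv V x := by
  rcases lt_or_gt_of_ne hx with h | h
  · have := hV.deriv_pos hl (neg_pos.2 h)
    rw [hV.deriv_neg] at this
    nlinarith
  · exact mul_pos h (hV.deriv_pos hl h)

theorem mul_deriv_nonneg (hl : 1 < l) (hV : GoodPotential l V) (x : ℝ) :
    0 ≤ x * deriv V x := by
  rcases eq_or_ne x 0 with rfl | h
  · simp
  · exact (hV.mul_deriv_pos hl h).le

theorem mul_deriv_far (hl : 1 < l) (hV : GoodPotential l V) :
    ∃ R, ∀ x, R ≤ |x| → |x| ^ (2 * l) ≤ x * deriv V x := by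
  obtain ⟨R, -, h⟩ := hV.deriv_far_pos hl
  refine ⟨R, fun x hx => (h _ hx).trans ?_⟩
  rcases abs_choice x with e | e <;> rw [e]
  rw [hV.deriv_neg]; linarith

theorem strictMonoOn (hl : 1 < l) (hV : GoodPotential l V) : StrictMonoOn V (Set.Ici 0) :=
  strictMonoOn_of_deriv_pos (convex_Ici 0) hV.smooth.continuous.continuousOn fun x hx => by
    rw [interior_Ici] at hx
    exact hV.deriv_pos hl hx

theorem zero_lt (hl : 1 < l) (hV : GoodPotential l V) {x : ℝ} (hx : x ≠ 0) : V 0 < V x := by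
  have h := hV.strictMonoOn hl (Set.mem_Ici.2 le_rfl) (Set.mem_Ici.2 (abs_nonneg x))
    (abs_pos.2 hx)
  rcases abs_choice x with e | e <;> rw [e] at h
  · exact h
  · rwa [hV.even] at h

theorem zero_le (hl : 1 < l) (hV : GoodPotential l V) (x : ℝ) : V 0 ≤ V x := by
  rcases eq_or_ne x 0 with rfl | h
  · exact le_rfl
  · exact (hV.zero_lt hl h).le

/-- Above a positive energy threshold, the virial and the energy are elliptic. -/
theorem elliptic (hl : 1 < l) (hV : GoodPotential l V) {E₁ : ℝ} (hE : V 0 < E₁) :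
    ∃ c, 0 < c ∧ ∀ z, E₁ < energy V z →
      c * lam l z.1 z.2 ^ (2 * l) ≤ z.1 * deriv V z.1 + 2 * z.2 ^ 2 ∧
      c * lam l z.1 z.2 ^ (2 * l) ≤ energy V z - V 0 := by
  obtain ⟨R₁, h₁⟩ := hV.value_far hl
  obtain ⟨R₂, h₂⟩ := hV.mul_deriv_far hl
  set R := max 1 (max R₁ R₂) with hR
  set e := E₁ - V 0 with he
  have he0 : 0 < e := sub_pos.2 hE
  have hcpt : IsCompact (Set.Icc (-R) R ∩ {x | V 0 + e / 2 ≤ V x}) :=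
    isCompact_Icc.inter_right (isClosed_le continuous_const hV.smooth.continuous)
  obtain ⟨δ, hδ, hδb⟩ := hcpt.exists_forall_le' (f := fun x => x * deriv V x) (a := 0)
    (continuous_id.mul hV.smooth_deriv.continuous).continuousOn (fun x hx => by
      refine hV.mul_deriv_pos hl ?_
      rintro rfl
      have := hx.2
      simp only [Set.mem_ofPred_eq] at this
      linarith)
  have hR0 : 0 < 1 + R ^ (2 * l) := by positivity
  set d := min (e / 2) δ with hd
  have hd0 : 0 < d := lt_min (by linarith) hδ
  refine ⟨min (1 / 8) (d / (1 + R ^ (2 * l))), lt_min (by norm_num) (by positivity), ?_⟩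
  rintro ⟨x, ξ⟩ hz
  set c := min (1 / 8) (d / (1 + R ^ (2 * l))) with hc
  have hc8 : c ≤ 1 / 8 := min_le_left _ _
  have hc0 : 0 < c := lt_min (by norm_num) (by positivity)
  have hcR : c * (1 + R ^ (2 * l)) ≤ d := by
    rw [← le_div_iff₀ hR0]; exact min_le_right _ _
  rw [lam_rpow (by linarith)]
  simp only [energy] at hz ⊢
  have hξ := sq_nonneg ξ
  rcases le_total R |x| with hx | hx
  · have a := h₁ x (((le_max_left _ _).trans (le_max_right _ _)).trans hx)
    have b := h₂ x (((le_max_right _ _).trans (le_max_right _ _)).trans hx)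
    have c1 : 1 ≤ |x| ^ (2 * l) := Real.one_le_rpow ((le_max_left _ _).trans hx) (by linarith)
    have : c * (1 + ξ ^ 2 + |x| ^ (2 * l)) ≤ 1 / 8 * (1 + ξ ^ 2 + |x| ^ (2 * l)) :=
      mul_le_mul_of_nonneg_right hc8 (by linarith)
    constructor <;> linarith
  · have c1 : |x| ^ (2 * l) ≤ R ^ (2 * l) :=
      Real.rpow_le_rpow (abs_nonneg x) hx (by linarith)
    have c2 : c * (1 + ξ ^ 2 + |x| ^ (2 * l)) ≤ d + 1 / 8 * ξ ^ 2 := by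
      nlinarith
    have hde : d ≤ e / 2 := min_le_left _ _
    have hv := hV.zero_le hl x
    have hm := hV.mul_deriv_nonneg hl x
    refine ⟨?_, by linarith⟩
    rcases le_total (e / 2) (ξ ^ 2) with h | h
    · linarith
    · have := hδb x ⟨abs_le.1 hx, by simp only [Set.mem_ofPred_eq]; linarith⟩
      linarith [min_le_right (e / 2) δ]

theorem energy_le (hl : 1 < l) (hV : GoodPotential l V) :
    ∃ C, 0 < C ∧ ∀ z, |energy V z| ≤ C * lam l z.1 z.2 ^ (2 * l) := by
  obtain ⟨C, hC⟩ := hV.growth 0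
  have hl0 : 0 < l := by linarith
  refine ⟨|C| * 2 ^ (2 * l) + 1, by positivity, fun z => ?_⟩
  have h1 := hC z.1
  simp only [iteratedDeriv_zero, Nat.cast_zero, sub_zero] at h1
  have hlam := lam_pos hl0 z.1 z.2
  have h2 : jap z.1 ^ (2 * l) ≤ 2 ^ (2 * l) * lam l z.1 z.2 ^ (2 * l) := by
    rw [← Real.mul_rpow (by norm_num) hlam.le]
    exact Real.rpow_le_rpow (jap_pos _).le (jap_le_two_mul_lam hl0 _ _) (by linarith)
  have h3 : z.2 ^ 2 ≤ lam l z.1 z.2 ^ (2 * l) := by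
    rw [lam_rpow hl0]
    have : 0 ≤ |z.1| ^ (2 * l) := by positivity
    linarith
  have h4 : |V z.1| ≤ |C| * (2 ^ (2 * l) * lam l z.1 z.2 ^ (2 * l)) :=
    h1.trans (mul_le_mul (le_abs_self C) h2 (Real.rpow_nonneg (jap_pos _).le _) (abs_nonneg C))
  calc |energy V z| ≤ z.2 ^ 2 + |V z.1| := 
        (abs_add_le _ _).trans_eq (by rw [abs_of_nonneg (sq_nonneg z.2)])
    _ ≤ _ := by nlinarith

end GoodPotential

/-- A unique positive simple root of a smooth family of functions depends smoothly on the
parameter. -/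
theorem contDiffOn_of_unique_pos_root {P : Type*} [NormedAddCommGroup P] [NormedSpace ℝ P]
    [CompleteSpace P] {O : Set P} (hO : IsOpen O) {F : P × ℝ → ℝ} (hF : ContDiff ℝ (⊤ : ℕ∞) F)
    {r : P → ℝ} (hr : ∀ y ∈ O, 0 < r y ∧ F (y, r y) = 0 ∧ ∀ s, 0 < s → F (y, s) = 0 → s = r y)
    (hd : ∀ y ∈ O, deriv (fun s => F (y, s)) (r y) ≠ 0) : ContDiffOn ℝ (⊤ : ℕ∞) r O := by
  intro y hy
  refine ContDiffAt.contDiffWithinAt ?_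
  have hn : ((⊤ : ℕ∞) : WithTop ℕ∞) ≠ 0 := by simp
  have cdf : ContDiffAt ℝ (⊤ : ℕ∞) F (y, r y) := hF.contDiffAt
  have hD := (hF.differentiable (by simp) (y, r y)).hasFDerivAt
  have hval : ∀ t : ℝ, (fderiv ℝ F (y, r y) ∘L .inr ℝ P ℝ) t
      = t * deriv (fun s => F (y, s)) (r y) := by
    intro t
    have h1 : HasDerivAt (fun s => F (y, s)) (fderiv ℝ F (y, r y) (0, 1)) (r y) :=
      hD.comp_hasDerivAt (r y) ((hasDerivAt_const (r y) y).prodMk (hasDerivAt_id (r y)))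
    rw [h1.deriv]
    have : ((0 : P), t) = t • ((0 : P), (1 : ℝ)) := by simp
    simp [this, -Prod.smul_mk]
  have inv : (fderiv ℝ F (y, r y) ∘L .inr ℝ P ℝ).IsInvertible := by
    refine ⟨ContinuousLinearEquiv.unitsEquivAut ℝ (Units.mk0 _ (hd y hy)), ?_⟩
    ext
    simpa using (hval 1).symm
  have hψ := cdf.contDiffAt_implicitFunction hn inv
  have hself := cdf.implicitFunction_apply_self hn inv
  have hev := cdf.eventually_apply_implicitFunction hn inv
  simp only at hψ hself hev
  refine hψ.congr_of_eventuallyEq ?_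
  have hpos : ∀ᶠ x in nhds y, 0 < cdf.implicitFunction hn inv x :=
    hψ.continuousAt.eventually (lt_mem_nhds (by rw [hself]; exact (hr y hy).1))
  filter_upwards [hev, hpos, hO.mem_nhds hy] with x h1 h2 h3
  exact ((hr x h3).2.2 _ h2 (by rw [h1, (hr y hy).2.1])).symm

/-- The virial `x V'(x) + 2ξ²`. -/
def virial (V : ℝ → ℝ) (z : ℝ × ℝ) : ℝ := z.1 * deriv V z.1 + 2 * z.2 ^ 2

/-- The point of the ray of slope `(A sin θ, B cos θ)` at parameter `r`. -/
def rayPoint (A B θ r : ℝ) : ℝ × ℝ := (r * (A * sin θ), r * (B * cos θ))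

open Classical in
/-- The parameter at which the ray of slope `(A sin θ, B cos θ)` meets the level `E`. -/
def radius (V : ℝ → ℝ) (A B θ E : ℝ) : ℝ :=
  if h : ∃ r, 0 < r ∧ energy V (rayPoint A B θ r) = E then h.choose else 0

/-- The level set of energy `E` parametrised by the (anisotropic) polar angle. -/
def orbit (V : ℝ → ℝ) (A B E θ : ℝ) : ℝ × ℝ := rayPoint A B θ (radius V A B θ E)

/-- The derivative of time with respect to the angle along the level set. -/
def clock (V : ℝ → ℝ) (A B E θ : ℝ) : ℝ :=
  radius V A B θ E ^ 2 * (A * B) / virial V (orbit V A B E θ)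

/-- The Hamiltonian vector field of the energy. -/
def flowDeriv (V : ℝ → ℝ) (u : ℝ × ℝ → ℝ) (z : ℝ × ℝ) : ℝ :=
  2 * z.2 * dPos u z - deriv V z.1 * dMom u z

section Orbit

variable {l : ℝ} {V : ℝ → ℝ} {A B : ℝ}

theorem rayPoint_ne (hA : 0 < A) (hB : 0 < B) (θ : ℝ) {r : ℝ} (hr : r ≠ 0) :
    rayPoint A B θ r ≠ 0 := by
  intro h
  have h1 : sin θ = 0 := by simpa [rayPoint, hr, hA.ne'] using congrArg Prod.fst h
  have h2 : cos θ = 0 := by simpa [rayPoint, hr, hB.ne'] using congrArg Prod.snd h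
  have := sin_sq_add_cos_sq θ
  simp [h1, h2] at this

theorem virial_pos (hl : 1 < l) (hV : GoodPotential l V) {z : ℝ × ℝ} (hz : z ≠ 0) :
    0 < virial V z := by
  rcases eq_or_ne z.1 0 with h | h
  · have : z.2 ≠ 0 := fun h' => hz (Prod.ext h h')
    simp only [virial, h, zero_mul, zero_add]
    positivity
  · have := hV.mul_deriv_pos hl h
    exact add_pos_of_pos_of_nonneg this (by positivity)

theorem ne_zero_of_lt_energy {z : ℝ × ℝ} (h : V 0 < energy V z) : z ≠ 0 := by
  rintro rfl
  simp [energy] at h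

theorem energy_zero : energy V 0 = V 0 := by simp [energy]

theorem energy_smooth (hV : GoodPotential l V) : ContDiff ℝ (⊤ : ℕ∞) (energy V) :=
  (contDiff_snd.pow 2).add (hV.smooth.comp contDiff_fst)

theorem virial_smooth (hV : GoodPotential l V) : ContDiff ℝ (⊤ : ℕ∞) (virial V) :=
  (contDiff_fst.mul (hV.smooth_deriv.comp contDiff_fst)).add
    (contDiff_const.mul (contDiff_snd.pow 2))

theorem hasDerivAt_energy_ray (hV : GoodPotential l V) (θ r : ℝ) :
    HasDerivAt (fun s => energy V (rayPoint A B θ s))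
      (2 * (r * (B * cos θ)) * (B * cos θ) + deriv V (r * (A * sin θ)) * (A * sin θ)) r := by
  have h1 : HasDerivAt (fun s : ℝ => s * (B * cos θ)) (B * cos θ) r := by
    simpa using (hasDerivAt_id r).mul_const (B * cos θ)
  have h2 : HasDerivAt (fun s : ℝ => s * (A * sin θ)) (A * sin θ) r := by
    simpa using (hasDerivAt_id r).mul_const (A * sin θ)
  exact ((h1.pow 2).add ((hV.hasDerivAt _).comp r h2)).congr_deriv (by simp)

theorem deriv_energy_ray_pos (hl : 1 < l) (hV : GoodPotential l V) (hA : 0 < A) (hB : 0 < B)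
    (θ : ℝ) {r : ℝ} (hr : 0 < r) : 0 < deriv (fun s => energy V (rayPoint A B θ s)) r := by
  rw [(hasDerivAt_energy_ray hV θ r).deriv]
  have h := virial_pos hl hV (rayPoint_ne hA hB θ hr.ne')
  simp only [virial, rayPoint] at h
  by_contra hn
  nlinarith

theorem strictMonoOn_energy_ray (hl : 1 < l) (hV : GoodPotential l V) (hA : 0 < A) (hB : 0 < B)
    (θ : ℝ) : StrictMonoOn (fun s => energy V (rayPoint A B θ s)) (Set.Ici 0) :=
  strictMonoOn_of_deriv_pos (convex_Ici 0)
    (fun r _ => (hasDerivAt_energy_ray hV θ r).continuousAt.continuousWithinAt) fun x hx => by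
    rw [interior_Ici] at hx
    exact deriv_energy_ray_pos hl hV hA hB θ hx

theorem exists_bound_of_energy_le (hl : 1 < l) (hV : GoodPotential l V) (E : ℝ) :
    ∃ M, ∀ z, energy V z ≤ E → |z.1| ≤ M ∧ |z.2| ≤ M := by
  obtain ⟨R, hR⟩ := hV.value_far hl
  refine ⟨|R| + 4 * |E - V 0| + 1, fun z hz => ?_⟩
  have h0 := abs_nonneg R
  have h1 := le_abs_self (E - V 0)
  have h2 := hV.zero_le hl z.1
  have h3 := abs_nonneg (E - V 0)
  simp only [energy] at hz
  constructor
  · by_contra! hn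
    have h4 := hR z.1 (by linarith [le_abs_self R])
    have h5 : |z.1| ^ (1 : ℝ) ≤ |z.1| ^ (2 * l) :=
      Real.rpow_le_rpow_of_exponent_le (by linarith) (by linarith)
    rw [Real.rpow_one] at h5
    nlinarith [sq_nonneg z.2]
  · have : z.2 ^ 2 = |z.2| ^ 2 := (sq_abs _).symm
    nlinarith [abs_nonneg z.2, sq_nonneg (|z.2| - 1)]

theorem exists_radius (hl : 1 < l) (hV : GoodPotential l V) (hA : 0 < A) (hB : 0 < B) {E : ℝ}
    (hE : V 0 < E) (θ : ℝ) : ∃ r, 0 < r ∧ energy V (rayPoint A B θ r) = E := by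
  obtain ⟨M, hM⟩ := exists_bound_of_energy_le hl hV E
  have h0 : energy V (rayPoint A B θ 0) = V 0 := by simp [energy, rayPoint]
  obtain ⟨s, hs0, hs⟩ : ∃ s, 0 < s ∧ E ≤ energy V (rayPoint A B θ s) := by
    by_contra! hn
    set m := min A B with hm
    have hm0 : 0 < m := lt_min hA hB
    have hMn : 0 ≤ M := (abs_nonneg _).trans (hM 0 (by rw [energy_zero]; exact hE.le)).1
    obtain ⟨h1, h2⟩ := hM _ (hn ((2 * M + 1) / m) (by positivity)).le
    simp only [rayPoint, abs_mul, abs_of_pos hA, abs_of_pos hB,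
      abs_of_pos (show 0 < (2 * M + 1) / m by positivity)] at h1 h2
    have h3 : (2 * M + 1) * |sin θ| ≤ M := by
      refine le_trans ?_ h1
      rw [← mul_assoc]
      refine mul_le_mul_of_nonneg_right ?_ (abs_nonneg _)
      rw [div_mul_eq_mul_div, le_div_iff₀ hm0]
      exact mul_le_mul_of_nonneg_left (min_le_left _ _) (by linarith)
    have h4 : (2 * M + 1) * |cos θ| ≤ M := by
      refine le_trans ?_ h2
      rw [← mul_assoc]
      refine mul_le_mul_of_nonneg_right ?_ (abs_nonneg _)
      rw [div_mul_eq_mul_div, le_div_iff₀ hm0]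
      exact mul_le_mul_of_nonneg_left (min_le_right _ _) (by linarith)
    have h5 : |sin θ| < 1 / 2 := by
      by_contra! h; nlinarith
    have h6 : |cos θ| < 1 / 2 := by
      by_contra! h; nlinarith
    have h7 := sin_sq_add_cos_sq θ
    rw [← sq_abs (sin θ), ← sq_abs (cos θ)] at h7
    nlinarith [abs_nonneg (sin θ), abs_nonneg (cos θ)]
  obtain ⟨r, hr, hre⟩ := intermediate_value_Icc hs0.le
    (f := fun s => energy V (rayPoint A B θ s))
    (fun r _ => (hasDerivAt_energy_ray hV θ r).continuousAt.continuousWithinAt)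
    (show E ∈ Set.Icc _ _ from ⟨by rw [h0]; exact hE.le, hs⟩)
  refine ⟨r, hr.1.lt_of_ne ?_, hre⟩
  rintro rfl
  simp only [h0] at hre
  exact hE.ne hre

theorem radius_pos (hl : 1 < l) (hV : GoodPotential l V) (hA : 0 < A) (hB : 0 < B) {E : ℝ}
    (hE : V 0 < E) (θ : ℝ) : 0 < radius V A B θ E := by
  rw [radius, dif_pos (exists_radius hl hV hA hB hE θ)]
  exact (exists_radius hl hV hA hB hE θ).choose_spec.1

theorem energy_orbit (hl : 1 < l) (hV : GoodPotential l V) (hA : 0 < A) (hB : 0 < B) {E : ℝ}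
    (hE : V 0 < E) (θ : ℝ) : energy V (orbit V A B E θ) = E := by
  rw [orbit, radius, dif_pos (exists_radius hl hV hA hB hE θ)]
  exact (exists_radius hl hV hA hB hE θ).choose_spec.2

theorem radius_unique (hl : 1 < l) (hV : GoodPotential l V) (hA : 0 < A) (hB : 0 < B) {E : ℝ}
    (hE : V 0 < E) (θ : ℝ) {r : ℝ} (hr : 0 < r) (h : energy V (rayPoint A B θ r) = E) :
    r = radius V A B θ E :=
  (strictMonoOn_energy_ray hl hV hA hB θ).injOn hr.le (radius_pos hl hV hA hB hE θ).le
    (h.trans (energy_orbit hl hV hA hB hE θ).symm)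

theorem radius_smooth (hl : 1 < l) (hV : GoodPotential l V) (hA : 0 < A) (hB : 0 < B) :
    ContDiffOn ℝ (⊤ : ℕ∞) (fun y : ℝ × ℝ => radius V A B y.1 y.2) (Set.univ ×ˢ Set.Ioi (V 0)) := by
  refine contDiffOn_of_unique_pos_root (isOpen_univ.prod isOpen_Ioi)
    (F := fun q => energy V (rayPoint A B q.1.1 q.2) - q.1.2) ?_ (fun y hy => ?_) fun y hy => ?_
  · refine ((energy_smooth hV).comp (ContDiff.prodMk ?_ ?_)).sub (contDiff_snd.comp contDiff_fst)
    · exact contDiff_snd.mul (contDiff_const.mul (contDiff_sin.comp (contDiff_fst.comp contDiff_fst)))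
    · exact contDiff_snd.mul (contDiff_const.mul (contDiff_cos.comp (contDiff_fst.comp contDiff_fst)))
  · have hE : V 0 < y.2 := hy.2
    exact ⟨radius_pos hl hV hA hB hE _, sub_eq_zero.2 (energy_orbit hl hV hA hB hE _),
      fun s hs h => radius_unique hl hV hA hB hE _ hs (sub_eq_zero.1 h)⟩
  · simp only [deriv_sub_const]
    exact (deriv_energy_ray_pos hl hV hA hB _ (radius_pos hl hV hA hB hy.2 _)).ne'

theorem orbit_smooth (hl : 1 < l) (hV : GoodPotential l V) (hA : 0 < A) (hB : 0 < B) :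
    ContDiffOn ℝ (⊤ : ℕ∞) (fun y : ℝ × ℝ => orbit V A B y.2 y.1) (Set.univ ×ˢ Set.Ioi (V 0)) :=
  ((radius_smooth hl hV hA hB).mul (contDiff_const.mul (contDiff_sin.comp contDiff_fst)).contDiffOn).prodMk
    ((radius_smooth hl hV hA hB).mul (contDiff_const.mul (contDiff_cos.comp contDiff_fst)).contDiffOn)

theorem orbit_ne (hl : 1 < l) (hV : GoodPotential l V) (hA : 0 < A) (hB : 0 < B) {E : ℝ}
    (hE : V 0 < E) (θ : ℝ) : orbit V A B E θ ≠ 0 :=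
  rayPoint_ne hA hB θ (radius_pos hl hV hA hB hE θ).ne'

theorem virial_orbit_pos (hl : 1 < l) (hV : GoodPotential l V) (hA : 0 < A) (hB : 0 < B) {E : ℝ}
    (hE : V 0 < E) (θ : ℝ) : 0 < virial V (orbit V A B E θ) :=
  virial_pos hl hV (orbit_ne hl hV hA hB hE θ)

theorem clock_pos (hl : 1 < l) (hV : GoodPotential l V) (hA : 0 < A) (hB : 0 < B) {E : ℝ}
    (hE : V 0 < E) (θ : ℝ) : 0 < clock V A B E θ :=
  div_pos (mul_pos (pow_pos (radius_pos hl hV hA hB hE θ) 2) (mul_pos hA hB))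
    (virial_orbit_pos hl hV hA hB hE θ)

theorem clock_smooth (hl : 1 < l) (hV : GoodPotential l V) (hA : 0 < A) (hB : 0 < B) :
    ContDiffOn ℝ (⊤ : ℕ∞) (fun y : ℝ × ℝ => clock V A B y.2 y.1) (Set.univ ×ˢ Set.Ioi (V 0)) :=
  (((radius_smooth hl hV hA hB).pow 2).mul contDiffOn_const).div
    ((virial_smooth hV).comp_contDiffOn (orbit_smooth hl hV hA hB))
    fun y hy => (virial_orbit_pos hl hV hA hB hy.2 y.1).ne'

theorem orbit_hasDerivAt (hl : 1 < l) (hV : GoodPotential l V) (hA : 0 < A) (hB : 0 < B) {E : ℝ}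
    (hE : V 0 < E) (θ : ℝ) :
    HasDerivAt (orbit V A B E) (clock V A B E θ * (2 * (orbit V A B E θ).2),
      clock V A B E θ * -deriv V (orbit V A B E θ).1) θ := by
  have hs := (radius_smooth hl hV hA hB).contDiffAt
    ((isOpen_univ.prod isOpen_Ioi).mem_nhds (show (θ, E) ∈ _ from ⟨Set.mem_univ _, hE⟩))
  have hρ : DifferentiableAt ℝ (fun t => radius V A B t E) θ :=
    (hs.differentiableAt (by simp)).comp θ
      (f := fun t : ℝ => (t, E)) (differentiableAt_id.prodMk (differentiableAt_const E))
  set ρ := radius V A B θ E with hρd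
  set ρ' := deriv (fun t => radius V A B t E) θ
  have h1 : HasDerivAt (fun t => radius V A B t E * (A * sin t))
      (ρ' * (A * sin θ) + ρ * (A * cos θ)) θ :=
    hρ.hasDerivAt.mul ((hasDerivAt_sin θ).const_mul A)
  have h2 : HasDerivAt (fun t => radius V A B t E * (B * cos t))
      (ρ' * (B * cos θ) + ρ * (B * -sin θ)) θ :=
    hρ.hasDerivAt.mul ((hasDerivAt_cos θ).const_mul B)
  set x := ρ * (A * sin θ) with hx
  set ξ := ρ * (B * cos θ) with hξ
  have hz : orbit V A B E θ = (x, ξ) := rfl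
  have h3 : 2 * ξ * (ρ' * (B * cos θ) + ρ * (B * -sin θ))
      + deriv V x * (ρ' * (A * sin θ) + ρ * (A * cos θ)) = 0 := by
    have h4 := (h2.pow 2).add ((hV.hasDerivAt x).comp θ h1)
    have h5 : (fun t => (radius V A B t E * (B * cos t)) ^ 2 + V (radius V A B t E * (A * sin t)))
        = fun _ => E := funext fun t => energy_orbit hl hV hA hB hE t
    have h6 := h4.unique (by
      have := hasDerivAt_const θ E
      rw [← h5] at this
      exact this)
    simpa using h6
  have hN := virial_orbit_pos hl hV hA hB hE θ
  rw [clock, hz] at *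
  simp only [virial] at hN ⊢
  have h7 : ξ * (ρ' * (A * sin θ) + ρ * (A * cos θ)) - x * (ρ' * (B * cos θ) + ρ * (B * -sin θ))
      = ρ ^ 2 * (A * B) := by
    rw [hx, hξ]
    linear_combination (ρ ^ 2 * (A * B)) * sin_sq_add_cos_sq θ
  clear_value x ξ
  refine (h1.prodMk h2).congr_deriv (Prod.ext ?_ ?_)
  · symm
    simp only [← hρd]
    rw [div_mul_eq_mul_div, div_eq_iff hN.ne']
    linear_combination (-2 * ξ) * h7 - x * h3
  · symm
    simp only [← hρd]
    rw [div_mul_eq_mul_div, div_eq_iff hN.ne']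
    linear_combination (deriv V x) * h7 - ξ * h3

theorem comp_orbit_hasDerivAt (hl : 1 < l) (hV : GoodPotential l V) (hA : 0 < A) (hB : 0 < B)
    {E : ℝ} (hE : V 0 < E) (θ : ℝ) {u : ℝ × ℝ → ℝ} (hu : DifferentiableAt ℝ u (orbit V A B E θ)) :
    HasDerivAt (fun t => u (orbit V A B E t))
      (clock V A B E θ * flowDeriv V u (orbit V A B E θ)) θ := by
  refine (hu.hasFDerivAt.comp_hasDerivAt θ (orbit_hasDerivAt hl hV hA hB hE θ)).congr_deriv ?_
  simp only [flowDeriv, dPos, dMom]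
  set z := orbit V A B E θ
  set κ := clock V A B E θ
  rw [show ((κ * (2 * z.2), κ * -deriv V z.1) : ℝ × ℝ)
    = (κ * (2 * z.2)) • ((1, 0) : ℝ × ℝ) + (κ * -deriv V z.1) • ((0, 1) : ℝ × ℝ) by
      simp, map_add, map_smul, map_smul]
  simp only [smul_eq_mul]
  ring

theorem radius_add_two_pi (θ E : ℝ) : radius V A B (θ + 2 * π) E = radius V A B θ E := by
  have h : rayPoint A B (θ + 2 * π) = rayPoint A B θ := by
    funext r
    simp only [rayPoint, sin_add_two_pi, cos_add_two_pi]
  classical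
  exact congrArg (fun f => if h : ∃ r, 0 < r ∧ energy V (f r) = E then h.choose else 0) h

theorem orbit_add_two_pi (θ E : ℝ) : orbit V A B E (θ + 2 * π) = orbit V A B E θ := by
  simp only [orbit, radius_add_two_pi, rayPoint, sin_add_two_pi, cos_add_two_pi]

theorem clock_add_two_pi (θ E : ℝ) : clock V A B E (θ + 2 * π) = clock V A B E θ := by
  simp only [clock, radius_add_two_pi, orbit_add_two_pi]

/-- Anisotropic polar coordinates. -/
theorem exists_rayPoint (hA : 0 < A) (hB : 0 < B) {z : ℝ × ℝ} (hz : z ≠ 0) :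
    ∃ θ ∈ Set.Ioc (-π) π, ∃ r, 0 < r ∧ z = rayPoint A B θ r := by
  set w : ℂ := ⟨z.2 / B, z.1 / A⟩ with hw
  have hw0 : w ≠ 0 := by
    intro h
    have h1 := congrArg Complex.re h
    have h2 := congrArg Complex.im h
    simp only [hw, Complex.zero_re, Complex.zero_im, div_eq_zero_iff, hA.ne', hB.ne', or_false]
      at h1 h2
    exact hz (Prod.ext h2 h1)
  refine ⟨w.arg, Complex.arg_mem_Ioc w, ‖w‖, norm_pos_iff.2 hw0, ?_⟩
  have h1 := Complex.norm_mul_cos_arg w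
  have h2 := Complex.norm_mul_sin_arg w
  simp only [hw] at h1 h2
  refine Prod.ext ?_ ?_
  · simp only [rayPoint]
    rw [mul_left_comm, h2]; field_simp
  · simp only [rayPoint]
    rw [mul_left_comm, h1]; field_simp

theorem rayPoint_eq_orbit (hl : 1 < l) (hV : GoodPotential l V) (hA : 0 < A) (hB : 0 < B)
    {θ r : ℝ} (hr : 0 < r) :
    rayPoint A B θ r = orbit V A B (energy V (rayPoint A B θ r)) θ := by
  have hE : V 0 < energy V (rayPoint A B θ r) := by
    have := strictMonoOn_energy_ray hl hV hA hB θ (Set.mem_Ici.2 le_rfl) (Set.mem_Ici.2 hr.le) hr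
    simpa [energy, rayPoint] using this
  rw [orbit, ← radius_unique hl hV hA hB hE θ hr rfl]

theorem exists_orbit (hl : 1 < l) (hV : GoodPotential l V) (hA : 0 < A) (hB : 0 < B)
    {z : ℝ × ℝ} (hz : z ≠ 0) :
    ∃ θ ∈ Set.Ioc (-π) π, z = orbit V A B (energy V z) θ := by
  obtain ⟨θ, hθ, r, hr, rfl⟩ := exists_rayPoint hA hB hz
  exact ⟨θ, hθ, rayPoint_eq_orbit hl hV hA hB hr⟩

end Orbit

/-- The region of phase space above an energy level. -/
def above (V : ℝ → ℝ) (E₁ : ℝ) : Set (ℝ × ℝ) := {z | E₁ < energy V z}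

/-- The integral of `g` over one period of the Hamiltonian flow on the level `E`. -/
def orbitInt (V : ℝ → ℝ) (g : ℝ × ℝ → ℝ) (E : ℝ) : ℝ :=
  ∫ θ in (0 : ℝ)..(2 * π), clock V 1 1 E θ * g (orbit V 1 1 E θ)

/-- The time average of `g` on the level `E`. -/
def mean (V : ℝ → ℝ) (g : ℝ × ℝ → ℝ) (E : ℝ) : ℝ := orbitInt V g E / orbitInt V (fun _ => 1) E

/-- The integral of `g` minus its average along the flow, from angle `0` to angle `θ`. -/
def orbitPrim (V : ℝ → ℝ) (g : ℝ × ℝ → ℝ) (E θ : ℝ) : ℝ :=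
  ∫ t in (0 : ℝ)..θ, clock V 1 1 E t * (g (orbit V 1 1 E t) - mean V g E)

/-- The solution of `{ξ² + V; u} = ⟨g⟩ - g` vanishing on the positive momentum axis. -/
def flowPrim (V : ℝ → ℝ) (g : ℝ × ℝ → ℝ) (z : ℝ × ℝ) : ℝ :=
  orbitPrim V g (energy V z) (Complex.arg ⟨z.2, z.1⟩)

theorem exists_local_angle {z₀ : ℝ × ℝ} (hz : z₀ ≠ 0) : ∃ α : ℝ × ℝ → ℝ,
    ContDiffAt ℝ (⊤ : ℕ∞) α z₀ ∧ ∀ᶠ z in nhds z₀, ∃ r, 0 < r ∧ z = rayPoint 1 1 (α z) r := by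
  obtain ⟨θ, -, r, hr, rfl⟩ := exists_rayPoint one_pos one_pos hz
  set a : ℝ × ℝ → ℝ := fun z => z.2 * cos θ + z.1 * sin θ with ha
  set b : ℝ × ℝ → ℝ := fun z => z.1 * cos θ - z.2 * sin θ with hb
  have has : ContDiff ℝ (⊤ : ℕ∞) a :=
    (contDiff_snd.mul contDiff_const).add (contDiff_fst.mul contDiff_const)
  have hbs : ContDiff ℝ (⊤ : ℕ∞) b :=
    (contDiff_fst.mul contDiff_const).sub (contDiff_snd.mul contDiff_const)
  have h0 : a (rayPoint 1 1 θ r) = r := by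
    simp only [ha, rayPoint]
    linear_combination r * sin_sq_add_cos_sq θ
  refine ⟨fun z => θ + arctan (b z / a z), ?_, ?_⟩
  · exact contDiffAt_const.add (contDiff_arctan.contDiffAt.comp _
      (hbs.contDiffAt.div has.contDiffAt (by rw [h0]; exact hr.ne')))
  · filter_upwards [has.continuous.continuousAt.eventually (lt_mem_nhds (by rw [h0]; exact hr))]
      with z haz
    have hs : 0 < √(1 + (b z / a z) ^ 2) := Real.sqrt_pos.2 (by positivity)
    have e1 : a z * √(1 + (b z / a z) ^ 2) * cos (arctan (b z / a z)) = a z := by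
      rw [cos_arctan]; field_simp
    have e2 : a z * √(1 + (b z / a z) ^ 2) * sin (arctan (b z / a z)) = b z := by
      rw [sin_arctan]; field_simp
    refine ⟨a z * √(1 + (b z / a z) ^ 2), mul_pos haz hs, Prod.ext ?_ ?_⟩
    · simp only [rayPoint, sin_add]
      linear_combination -sin θ * e1 - cos θ * e2 - z.1 * sin_sq_add_cos_sq θ
    · simp only [rayPoint, cos_add]
      linear_combination -cos θ * e1 + sin θ * e2 - z.2 * sin_sq_add_cos_sq θ

section Mean

variable {l : ℝ} {V : ℝ → ℝ} {E₁ E : ℝ} {g h u : ℝ × ℝ → ℝ}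

theorem isOpen_above (hV : GoodPotential l V) : IsOpen (above V E₁) :=
  isOpen_lt continuous_const (energy_smooth hV).continuous

theorem orbit_mem_above (hl : 1 < l) (hV : GoodPotential l V) {A B : ℝ} (hA : 0 < A) (hB : 0 < B)
    (hE₁ : V 0 ≤ E₁) (hE : E₁ < E) (θ : ℝ) : orbit V A B E θ ∈ above V E₁ := by
  rw [above, Set.mem_ofPred_eq, energy_orbit hl hV hA hB (hE₁.trans_lt hE)]
  exact hE

theorem smooth_along_orbit (hl : 1 < l) (hV : GoodPotential l V) (hE₁ : V 0 ≤ E₁)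
    (hg : ContDiffOn ℝ (⊤ : ℕ∞) g (above V E₁)) :
    ContDiffOn ℝ (⊤ : ℕ∞) (fun y : ℝ × ℝ => g (orbit V 1 1 y.2 y.1)) (Set.univ ×ˢ Set.Ioi E₁) :=
  hg.comp ((orbit_smooth hl hV one_pos one_pos).mono
    (Set.prod_mono_right (Set.Ioi_subset_Ioi hE₁)))
    fun y hy => orbit_mem_above hl hV one_pos one_pos hE₁ hy.2 y.1

theorem smooth_clock (hl : 1 < l) (hV : GoodPotential l V) (hE₁ : V 0 ≤ E₁) :
    ContDiffOn ℝ (⊤ : ℕ∞) (fun y : ℝ × ℝ => clock V 1 1 y.2 y.1) (Set.univ ×ˢ Set.Ioi E₁) :=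
  (clock_smooth hl hV one_pos one_pos).mono (Set.prod_mono_right (Set.Ioi_subset_Ioi hE₁))

theorem continuous_slice {K : ℝ × ℝ → ℝ}
    (hK : ContDiffOn ℝ (⊤ : ℕ∞) K (Set.univ ×ˢ Set.Ioi E₁)) (hE : E₁ < E) :
    Continuous (fun t => K (t, E)) :=
  continuousOn_univ.1 <| hK.continuousOn.comp (f := fun t : ℝ => (t, E))
    (continuous_id.prodMk continuous_const).continuousOn fun _ _ => ⟨Set.mem_univ _, hE⟩

theorem continuous_clock (hl : 1 < l) (hV : GoodPotential l V) (hE : V 0 < E) :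
    Continuous (fun t => clock V 1 1 E t) :=
  continuous_slice (smooth_clock hl hV le_rfl) hE

theorem continuous_along_orbit (hl : 1 < l) (hV : GoodPotential l V) (hE₁ : V 0 ≤ E₁)
    (hE : E₁ < E) (hg : ContDiffOn ℝ (⊤ : ℕ∞) g (above V E₁)) :
    Continuous (fun t => g (orbit V 1 1 E t)) :=
  continuous_slice (smooth_along_orbit hl hV hE₁ hg) hE

theorem intervalIntegrable_orbit (hl : 1 < l) (hV : GoodPotential l V) (hE₁ : V 0 ≤ E₁)
    (hE : E₁ < E) (hg : ContDiffOn ℝ (⊤ : ℕ∞) g (above V E₁)) (a b : ℝ) :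
    IntervalIntegrable (fun t => clock V 1 1 E t * g (orbit V 1 1 E t)) volume a b :=
  ((continuous_clock hl hV (hE₁.trans_lt hE)).mul
    (continuous_along_orbit hl hV hE₁ hE hg)).intervalIntegrable a b

theorem orbitInt_smooth (hl : 1 < l) (hV : GoodPotential l V) (hE₁ : V 0 ≤ E₁)
    (hg : ContDiffOn ℝ (⊤ : ℕ∞) g (above V E₁)) :
    ContDiffOn ℝ (⊤ : ℕ∞) (orbitInt V g) (Set.Ioi E₁) :=
  (contDiffOn_primitive_param isOpen_Ioi
    ((smooth_clock hl hV hE₁).mul (smooth_along_orbit hl hV hE₁ hg))).comp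
    (f := fun E : ℝ => (2 * π, E)) (contDiff_const.prodMk contDiff_id).contDiffOn
    fun _ hE => ⟨Set.mem_univ _, hE⟩

theorem orbitInt_one_pos (hl : 1 < l) (hV : GoodPotential l V) (hE : V 0 < E) :
    0 < orbitInt V (fun _ => 1) E := by
  refine intervalIntegral_pos_of_pos ?_ (fun t => ?_) two_pi_pos
  · simpa using (continuous_clock hl hV hE).intervalIntegrable 0 (2 * π)
  · simpa using clock_pos hl hV one_pos one_pos hE t

theorem mean_smooth (hl : 1 < l) (hV : GoodPotential l V) (hE₁ : V 0 ≤ E₁)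
    (hg : ContDiffOn ℝ (⊤ : ℕ∞) g (above V E₁)) :
    ContDiffOn ℝ (⊤ : ℕ∞) (mean V g) (Set.Ioi E₁) :=
  (orbitInt_smooth hl hV hE₁ hg).div (orbitInt_smooth hl hV hE₁ contDiffOn_const)
    fun _ hE => (orbitInt_one_pos hl hV (hE₁.trans_lt hE)).ne'

theorem orbitInt_add (hl : 1 < l) (hV : GoodPotential l V) (hE₁ : V 0 ≤ E₁) (hE : E₁ < E)
    (hg : ContDiffOn ℝ (⊤ : ℕ∞) g (above V E₁)) (hh : ContDiffOn ℝ (⊤ : ℕ∞) h (above V E₁)) :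
    orbitInt V (fun z => g z + h z) E = orbitInt V g E + orbitInt V h E := by
  simp only [orbitInt, mul_add]
  exact intervalIntegral.integral_add (intervalIntegrable_orbit hl hV hE₁ hE hg _ _)
    (intervalIntegrable_orbit hl hV hE₁ hE hh _ _)

theorem orbitInt_congr (hl : 1 < l) (hV : GoodPotential l V) (hE : V 0 < E)
    (e : ∀ z, energy V z = E → g z = h z) : orbitInt V g E = orbitInt V h E := by
  simp only [orbitInt, fun θ => e _ (energy_orbit hl hV one_pos one_pos hE θ)]

theorem orbitInt_const_mul (c : ℝ) : orbitInt V (fun z => c * g z) E = c * orbitInt V g E := by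
  simp only [orbitInt, ← intervalIntegral.integral_const_mul, mul_left_comm]

theorem mean_add (hl : 1 < l) (hV : GoodPotential l V) (hE₁ : V 0 ≤ E₁) (hE : E₁ < E)
    (hg : ContDiffOn ℝ (⊤ : ℕ∞) g (above V E₁)) (hh : ContDiffOn ℝ (⊤ : ℕ∞) h (above V E₁)) :
    mean V (fun z => g z + h z) E = mean V g E + mean V h E := by
  rw [mean, mean, mean, orbitInt_add hl hV hE₁ hE hg hh, add_div]

theorem mean_congr (hl : 1 < l) (hV : GoodPotential l V) (hE : V 0 < E)
    (e : ∀ z, energy V z = E → g z = h z) : mean V g E = mean V h E := by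
  rw [mean, mean, orbitInt_congr hl hV hE e]

theorem mean_const_mul (c : ℝ) : mean V (fun z => c * g z) E = c * mean V g E := by
  rw [mean, mean, orbitInt_const_mul, mul_div_assoc]

theorem mean_comp_mul (hl : 1 < l) (hV : GoodPotential l V) (hE : V 0 < E) (f : ℝ → ℝ) :
    mean V (fun z => f (energy V z) * g z) E = f E * mean V g E := by
  rw [← mean_const_mul]
  exact mean_congr hl hV hE fun z hz => by rw [hz]

theorem mean_one (hl : 1 < l) (hV : GoodPotential l V) (hE : V 0 < E) :
    mean V (fun _ => 1) E = 1 :=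
  div_self (orbitInt_one_pos hl hV hE).ne'

theorem abs_mean_le (hl : 1 < l) (hV : GoodPotential l V) (hE : V 0 < E) {M : ℝ}
    (hM : ∀ θ, |g (orbit V 1 1 E θ)| ≤ M) : |mean V g E| ≤ M := by
  have h1 := orbitInt_one_pos hl hV hE
  rw [mean, abs_div, abs_of_pos h1, div_le_iff₀ h1, ← Real.norm_eq_abs, orbitInt, orbitInt,
    ← intervalIntegral.integral_const_mul]
  refine norm_integral_le_of_norm_le two_pi_pos.le (Filter.Eventually.of_forall fun t _ => ?_)
    (((continuous_clock hl hV hE).mul_const 1).const_mul M |>.intervalIntegrable _ _)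
  have h2 := clock_pos hl hV one_pos one_pos hE t
  rw [Real.norm_eq_abs, abs_mul, abs_of_pos h2, mul_one, mul_comm M]
  exact mul_le_mul_of_nonneg_left (hM t) h2.le

theorem mean_flowDeriv (hl : 1 < l) (hV : GoodPotential l V) (hE₁ : V 0 ≤ E₁) (hE : E₁ < E)
    (hu : ContDiffOn ℝ (⊤ : ℕ∞) u (above V E₁)) : mean V (flowDeriv V u) E = 0 := by
  have hU := isOpen_above (E₁ := E₁) hV
  have hs : ContDiffOn ℝ (⊤ : ℕ∞) (flowDeriv V u) (above V E₁) :=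
    ((contDiff_const.mul contDiff_snd).contDiffOn.mul (dPos_smooth hU hu)).sub
      ((hV.smooth_deriv.comp contDiff_fst).contDiffOn.mul (dMom_smooth hU hu))
  have : orbitInt V (flowDeriv V u) E = 0 := by
    rw [orbitInt, integral_eq_sub_of_hasDerivAt (fun θ _ => comp_orbit_hasDerivAt hl hV one_pos
      one_pos (hE₁.trans_lt hE) θ (smooth_differentiableAt hU hu
        (orbit_mem_above hl hV one_pos one_pos hE₁ hE θ)))
      (intervalIntegrable_orbit hl hV hE₁ hE hs _ _), sub_eq_zero]
    congr 1
    simpa using orbit_add_two_pi (V := V) (A := 1) (B := 1) 0 E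
  rw [mean, this, zero_div]

theorem orbitPrim_add_two_pi (hl : 1 < l) (hV : GoodPotential l V) (hE₁ : V 0 ≤ E₁) (hE : E₁ < E)
    (hg : ContDiffOn ℝ (⊤ : ℕ∞) g (above V E₁)) : Function.Periodic (orbitPrim V g E) (2 * π) := by
  intro θ
  have hs : ContDiffOn ℝ (⊤ : ℕ∞) (fun z => g z - mean V g E) (above V E₁) :=
    hg.sub contDiffOn_const
  have hi := intervalIntegrable_orbit hl hV hE₁ hE hs
  have hE0 := hE₁.trans_lt hE
  have per : Function.Periodic
      (fun t => clock V 1 1 E t * (g (orbit V 1 1 E t) - mean V g E)) (2 * π) := fun t => by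
    simp only [clock_add_two_pi, orbit_add_two_pi]
  rw [orbitPrim, orbitPrim, ← integral_add_adjacent_intervals (hi 0 θ) (hi θ (θ + 2 * π)),
    per.intervalIntegral_add_eq θ 0, zero_add, add_eq_left]
  have h1 := intervalIntegrable_orbit hl hV hE₁ hE hg 0 (2 * π)
  have h2 := ((continuous_clock hl hV hE0).mul_const (mean V g E)).intervalIntegrable
    (μ := volume) 0 (2 * π)
  simp only [mul_sub]
  rw [intervalIntegral.integral_sub h1 h2, intervalIntegral.integral_mul_const, sub_eq_zero]
  have h3 := (orbitInt_one_pos hl hV hE0).ne'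
  have h4 : orbitInt V (fun _ => 1) E * mean V g E = orbitInt V g E := by
    rw [mean]; field_simp
  simpa [orbitInt] using h4.symm

theorem flowPrim_ray (hl : 1 < l) (hV : GoodPotential l V) (hE₁ : V 0 ≤ E₁)
    (hg : ContDiffOn ℝ (⊤ : ℕ∞) g (above V E₁)) {θ r : ℝ} (hr : 0 < r)
    (hz : rayPoint 1 1 θ r ∈ above V E₁) :
    flowPrim V g (rayPoint 1 1 θ r) = orbitPrim V g (energy V (rayPoint 1 1 θ r)) θ := by
  have hp := orbitPrim_add_two_pi hl hV hE₁ hz hg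
  have h1 := Complex.arg_mul_cos_add_sin_mul_I_coe_angle hr (θ : Real.Angle)
  have h2 : (r : ℂ) * ((θ : Real.Angle).cos + (θ : Real.Angle).sin * Complex.I)
      = ⟨(rayPoint 1 1 θ r).2, (rayPoint 1 1 θ r).1⟩ := by
    apply Complex.ext <;> simp [rayPoint, Complex.cos_ofReal_re, Complex.sin_ofReal_re]
  rw [h2, Real.Angle.angle_eq_iff_two_pi_dvd_sub] at h1
  obtain ⟨k, hk⟩ := h1
  rw [flowPrim, sub_eq_iff_eq_add.1 hk, mul_comm, add_comm]
  exact hp.int_mul k θ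

theorem flowPrim_orbit (hl : 1 < l) (hV : GoodPotential l V) (hE₁ : V 0 ≤ E₁) (hE : E₁ < E)
    (hg : ContDiffOn ℝ (⊤ : ℕ∞) g (above V E₁)) (θ : ℝ) :
    flowPrim V g (orbit V 1 1 E θ) = orbitPrim V g E θ := by
  have hE0 := hE₁.trans_lt hE
  have h := flowPrim_ray hl hV hE₁ hg (radius_pos hl hV one_pos one_pos hE0 θ)
    (orbit_mem_above hl hV one_pos one_pos hE₁ hE θ)
  rwa [← orbit, energy_orbit hl hV one_pos one_pos hE0] at h

theorem flowPrim_axis (hl : 1 < l) (hV : GoodPotential l V) (hE₁ : V 0 ≤ E₁)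
    (hg : ContDiffOn ℝ (⊤ : ℕ∞) g (above V E₁)) {ξ : ℝ} (hξ : 0 < ξ)
    (hz : ((0 : ℝ), ξ) ∈ above V E₁) : flowPrim V g (0, ξ) = 0 := by
  have e : rayPoint 1 1 0 ξ = (0, ξ) := by simp [rayPoint]
  rw [← e] at hz ⊢
  rw [flowPrim_ray hl hV hE₁ hg hξ hz, orbitPrim, integral_same]

theorem flowPrim_smooth (hl : 1 < l) (hV : GoodPotential l V) (hE₁ : V 0 ≤ E₁)
    (hg : ContDiffOn ℝ (⊤ : ℕ∞) g (above V E₁)) :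
    ContDiffOn ℝ (⊤ : ℕ∞) (flowPrim V g) (above V E₁) := by
  have hU := isOpen_above (E₁ := E₁) hV
  intro z hz
  obtain ⟨α, hα, hev⟩ := exists_local_angle (ne_zero_of_lt_energy (hE₁.trans_lt hz))
  have h1 := contDiffOn_primitive_param (isOpen_Ioi (a := E₁))
    ((smooth_clock hl hV hE₁).mul ((smooth_along_orbit hl hV hE₁ hg).sub
      ((mean_smooth hl hV hE₁ hg).comp contDiffOn_snd fun y hy => hy.2)))
  have h2 : ContDiffAt ℝ (⊤ : ℕ∞) (fun w => orbitPrim V g (energy V w) (α w)) z :=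
    (h1.contDiffAt ((isOpen_univ.prod isOpen_Ioi).mem_nhds
      (show (α z, energy V z) ∈ _ from ⟨Set.mem_univ _, hz⟩))).comp
      (f := fun w : ℝ × ℝ => (α w, energy V w)) z
      (hα.prodMk (energy_smooth hV).contDiffAt)
  refine (h2.congr_of_eventuallyEq ?_).contDiffWithinAt
  filter_upwards [hev, hU.mem_nhds hz] with w ⟨r, hr, hw⟩ hwU
  rw [hw] at hwU
  have h3 := flowPrim_ray hl hV hE₁ hg hr hwU
  rwa [← hw] at h3

theorem flowDeriv_flowPrim (hl : 1 < l) (hV : GoodPotential l V) (hE₁ : V 0 ≤ E₁)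
    (hg : ContDiffOn ℝ (⊤ : ℕ∞) g (above V E₁)) {z : ℝ × ℝ} (hz : z ∈ above V E₁) :
    flowDeriv V (flowPrim V g) z = g z - mean V g (energy V z) := by
  have hE0 : V 0 < energy V z := hE₁.trans_lt hz
  obtain ⟨θ, -, hθ⟩ := exists_orbit hl hV one_pos one_pos (ne_zero_of_lt_energy hE0)
  set E := energy V z
  have h1 := comp_orbit_hasDerivAt hl hV one_pos one_pos hE0 θ (u := flowPrim V g)
    (by rw [← hθ]; exact smooth_differentiableAt (isOpen_above hV) (flowPrim_smooth hl hV hE₁ hg) hz)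
  rw [show (fun t => flowPrim V g (orbit V 1 1 E t)) = orbitPrim V g E from
    funext fun t => flowPrim_orbit hl hV hE₁ hz hg t] at h1
  have hc : Continuous fun t => clock V 1 1 E t * (g (orbit V 1 1 E t) - mean V g E) :=
    (continuous_clock hl hV hE0).mul ((continuous_along_orbit hl hV hE₁ hz hg).sub continuous_const)
  have h2 : HasDerivAt (orbitPrim V g E) _ θ :=
    integral_hasDerivAt_right (hc.intervalIntegrable 0 θ)
      (hc.stronglyMeasurableAtFilter volume (nhds θ)) hc.continuousAt
  have h3 := mul_left_cancel₀ (clock_pos hl hV one_pos one_pos hE0 θ).ne' (h1.unique h2)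
  rwa [← hθ] at h3

theorem mean_eq_zero (hl : 1 < l) (hV : GoodPotential l V) (hE : V 0 < E)
    (h0 : ∀ z, energy V z = E → g z = 0) : mean V g E = 0 := by
  rw [mean_congr hl hV hE (h := fun z => 0 * g z) (fun z hz => by rw [h0 z hz, zero_mul]),
    mean_const_mul, zero_mul]

theorem flowPrim_eq_zero (hl : 1 < l) (hV : GoodPotential l V) {z : ℝ × ℝ} (hz : V 0 < energy V z)
    (h0 : ∀ w, energy V w = energy V z → g w = 0) : flowPrim V g z = 0 := by
  rw [flowPrim, orbitPrim]
  simp [fun t => h0 _ (energy_orbit hl hV one_pos one_pos hz t), mean_eq_zero hl hV hz h0]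

end Mean

/-- The quasi-homogeneous virial `x V'(x) + 2lξ²`. -/
def quasiVirial (l : ℝ) (V : ℝ → ℝ) (z : ℝ × ℝ) : ℝ := z.1 * deriv V z.1 + 2 * l * z.2 ^ 2

/-- The derivative along the normalised dilation field `(x∂_x + lξ∂_ξ) / (x V' + 2lξ²)`, under
which the energy has derivative `1`. -/
def dilate (l : ℝ) (V : ℝ → ℝ) (v : ℝ × ℝ → ℝ) (z : ℝ × ℝ) : ℝ :=
  (quasiVirial l V z)⁻¹ * (z.1 * dPos v z + l * z.2 * dMom v z)

/-- The defect of commutation of the dilation field with the Hamiltonian field. -/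
def defect (l : ℝ) (V : ℝ → ℝ) (z : ℝ × ℝ) : ℝ :=
  (l - 1) * (quasiVirial l V z)⁻¹ + (quasiVirial l V z)⁻¹ * (quasiVirial l V z)⁻¹ *
    (z.1 * (z.1 * deriv (deriv V) z.1 + (1 - 2 * l) * deriv V z.1))

section Dilation

variable {l : ℝ} {V : ℝ → ℝ} {E₁ : ℝ} {U : Set (ℝ × ℝ)} {v : ℝ × ℝ → ℝ} {a b : ℝ} {z : ℝ × ℝ}

theorem symb_potential (hV : GoodPotential l V) : Symb l U 0 (2 * l) (fun z => V z.1) :=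
  Symb.of_pos hV.smooth hV.growth

theorem symb_force (hV : GoodPotential l V) : Symb l U 0 (2 * l - 1) (fun z => deriv V z.1) :=
  Symb.of_pos hV.smooth_deriv fun k => by
    obtain ⟨C, hC⟩ := hV.growth (k + 1)
    refine ⟨C, fun x => ?_⟩
    have := hC x
    rw [iteratedDeriv_succ'] at this
    rwa [show 2 * l - 1 - (k : ℝ) = 2 * l - ((k + 1 : ℕ) : ℝ) by push_cast; ring]

theorem smooth_deriv_deriv (hV : GoodPotential l V) : ContDiff ℝ (⊤ : ℕ∞) (deriv (deriv V)) := by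
  have := hV.smooth_deriv
  exact (contDiff_infty_iff_deriv.1 this).2

theorem symb_force_deriv (hV : GoodPotential l V) :
    Symb l U 0 (2 * l - 2) (fun z => deriv (deriv V) z.1) :=
  Symb.of_pos (smooth_deriv_deriv hV) fun k => by
    obtain ⟨C, hC⟩ := hV.growth (k + 1 + 1)
    refine ⟨C, fun x => ?_⟩
    have := hC x
    rw [iteratedDeriv_succ', iteratedDeriv_succ'] at this
    rwa [show 2 * l - 2 - (k : ℝ) = 2 * l - ((k + 1 + 1 : ℕ) : ℝ) by push_cast; ring]

theorem symb_energy (hl : 1 < l) (hV : GoodPotential l V) (hU : IsOpen U) :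
    Symb l U (2 * l) 0 (energy V) := by
  have h0 : 0 < l := by linarith
  refine Symb.congr hU (Symb.add hU ((Symb.mom h0).mul h0 hU (Symb.mom h0) |>.weaken h0
    (by linarith) (by linarith)) ((symb_potential hV).weaken h0 (by linarith) (by linarith)))
    fun z _ => ?_
  simp only [energy, sq]

theorem symb_quasiVirial (hl : 1 < l) (hV : GoodPotential l V) (hU : IsOpen U) :
    Symb l U (2 * l) 0 (quasiVirial l V) := by
  have h0 : 0 < l := by linarith
  refine Symb.congr hU (Symb.add hU
    ((Symb.pos.mul h0 hU (symb_force hV)).weaken h0 (by linarith) (by linarith))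
    (((Symb.mom h0).mul h0 hU (Symb.mom h0) |>.weaken h0 (a' := 2 * l) (b' := 0)
    (by linarith) (by linarith)).const_mul h0 hU (2 * l))) fun z _ => ?_
  simp only [quasiVirial, sq]

theorem quasiVirial_pos (hl : 1 < l) (hV : GoodPotential l V) (hz : z ≠ 0) :
    0 < quasiVirial l V z := by
  have h1 := virial_pos hl hV hz
  simp only [virial, quasiVirial] at *
  nlinarith [sq_nonneg z.2]

theorem symb_inv_quasiVirial (hl : 1 < l) (hV : GoodPotential l V) (hE₁ : V 0 < E₁) :
    Symb l (above V E₁) (-(2 * l)) 0 (fun z => (quasiVirial l V z)⁻¹) := by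
  obtain ⟨c, hc, h⟩ := hV.elliptic hl hE₁
  have hU := isOpen_above (E₁ := E₁) hV
  have := (symb_quasiVirial hl hV hU).inv (zero_lt_one.trans hl) hU hc fun z hz => by
    refine le_trans ?_ ((h z hz).1.trans ?_)
    · simp [wt]
    · simp only [quasiVirial]
      nlinarith [sq_nonneg z.2]
  simpa using this

theorem symb_defect (hl : 1 < l) (hV : GoodPotential l V) (hE₁ : V 0 < E₁) :
    Symb l (above V E₁) (-(2 * l)) 0 (defect l V) := by
  have h0 : 0 < l := by linarith
  have hU := isOpen_above (E₁ := E₁) hV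
  have hq := symb_inv_quasiVirial hl hV hE₁
  refine (hq.const_mul h0 hU (l - 1)).add hU (((hq.mul h0 hU hq).mul h0 hU
    (Symb.pos.mul h0 hU (Symb.add hU (a := 0) (b := 2 * l - 1) ?_
      ((symb_force hV).const_mul h0 hU _)))).weaken h0 (by linarith) (by linarith))
  exact (Symb.pos.mul h0 hU (symb_force_deriv hV)).weaken h0 (by linarith) (by linarith)

theorem symb_dilate (hl : 1 < l) (hV : GoodPotential l V) (hE₁ : V 0 < E₁)
    (hv : Symb l (above V E₁) a b v) : Symb l (above V E₁) (a - 2 * l) b (dilate l V v) := by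
  have h0 : 0 < l := by linarith
  have hU := isOpen_above (E₁ := E₁) hV
  refine ((symb_inv_quasiVirial hl hV hE₁).mul h0 hU (Symb.add hU (a := a) (b := b)
    ((Symb.pos.mul h0 hU (hv.derivPos hU)).weaken h0 (by linarith) (by linarith))
    ((((Symb.mom h0).const_mul h0 hU l).mul h0 hU (hv.derivMom hU)).weaken h0
      (by linarith) (by linarith)))).weaken h0 (by linarith) (by linarith)

theorem dPos_energy (hV : GoodPotential l V) (z : ℝ × ℝ) : dPos (energy V) z = deriv V z.1 := by
  have h1 : DifferentiableAt ℝ (fun w : ℝ × ℝ => w.2) z := differentiableAt_snd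
  have h2 := (hV.hasDerivAt z.1).differentiableAt
  have h3 : DifferentiableAt ℝ (fun w : ℝ × ℝ => V w.1) z := h2.comp z differentiableAt_fst
  have e : energy V = fun w => w.2 * w.2 + V w.1 := funext fun w => by simp only [energy, sq]
  rw [e, dPos_add (h1.fun_mul h1) h3, dPos_mul h1 h1, dPos_snd,
    dPos_comp h2 differentiableAt_fst, dPos_fst]
  ring

theorem dMom_energy (hV : GoodPotential l V) (z : ℝ × ℝ) : dMom (energy V) z = 2 * z.2 := by
  have h1 : DifferentiableAt ℝ (fun w : ℝ × ℝ => w.2) z := differentiableAt_snd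
  have h2 := (hV.hasDerivAt z.1).differentiableAt
  have h3 : DifferentiableAt ℝ (fun w : ℝ × ℝ => V w.1) z := h2.comp z differentiableAt_fst
  have e : energy V = fun w => w.2 * w.2 + V w.1 := funext fun w => by simp only [energy, sq]
  rw [e, dMom_add (h1.fun_mul h1) h3, dMom_mul h1 h1, dMom_snd,
    dMom_comp h2 differentiableAt_fst, dMom_fst]
  ring

theorem dPos_quasiVirial (hV : GoodPotential l V) (z : ℝ × ℝ) :
    dPos (quasiVirial l V) z = deriv V z.1 + z.1 * deriv (deriv V) z.1 := by
  have h1 : DifferentiableAt ℝ (fun w : ℝ × ℝ => w.2) z := differentiableAt_snd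
  have h0 : DifferentiableAt ℝ (fun w : ℝ × ℝ => w.1) z := differentiableAt_fst
  have h2 : DifferentiableAt ℝ (deriv V) z.1 := hV.smooth_deriv.differentiable (by simp) z.1
  have h3 : DifferentiableAt ℝ (fun w : ℝ × ℝ => deriv V w.1) z := h2.comp z h0
  have e : quasiVirial l V = fun w => w.1 * deriv V w.1 + 2 * l * (w.2 * w.2) :=
    funext fun w => by simp only [quasiVirial, sq]
  rw [e, dPos_add (h0.fun_mul h3) ((h1.fun_mul h1).const_mul (2 * l)), dPos_mul h0 h3,
    dPos_mul (differentiableAt_const _) (h1.fun_mul h1), dPos_mul h1 h1, dPos_const, dPos_snd, dPos_fst,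
    dPos_comp h2 h0, dPos_fst]
  ring

theorem dMom_quasiVirial (hV : GoodPotential l V) (z : ℝ × ℝ) :
    dMom (quasiVirial l V) z = 4 * l * z.2 := by
  have h1 : DifferentiableAt ℝ (fun w : ℝ × ℝ => w.2) z := differentiableAt_snd
  have h0 : DifferentiableAt ℝ (fun w : ℝ × ℝ => w.1) z := differentiableAt_fst
  have h2 : DifferentiableAt ℝ (deriv V) z.1 := hV.smooth_deriv.differentiable (by simp) z.1
  have h3 : DifferentiableAt ℝ (fun w : ℝ × ℝ => deriv V w.1) z := h2.comp z h0
  have e : quasiVirial l V = fun w => w.1 * deriv V w.1 + 2 * l * (w.2 * w.2) :=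
    funext fun w => by simp only [quasiVirial, sq]
  rw [e, dMom_add (h0.fun_mul h3) ((h1.fun_mul h1).const_mul (2 * l)), dMom_mul h0 h3,
    dMom_mul (differentiableAt_const _) (h1.fun_mul h1), dMom_mul h1 h1, dMom_const, dMom_snd, dMom_fst,
    dMom_comp h2 h0, dMom_fst]
  ring

theorem dMom_eq (hl : 1 < l) (hV : GoodPotential l V) (hz : z ≠ 0) :
    dMom v z = 2 * z.2 * dilate l V v z - (quasiVirial l V z)⁻¹ * (z.1 * flowDeriv V v z) := by
  have := (quasiVirial_pos hl hV hz).ne'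
  simp only [dilate, flowDeriv]
  field_simp
  simp only [quasiVirial]
  ring

theorem dPos_eq (hl : 1 < l) (hV : GoodPotential l V) (hz : z ≠ 0) :
    dPos v z = (quasiVirial l V z)⁻¹ * (l * z.2 * flowDeriv V v z)
      + deriv V z.1 * dilate l V v z := by
  have := (quasiVirial_pos hl hV hz).ne'
  simp only [dilate, flowDeriv]
  field_simp
  simp only [quasiVirial]
  ring

theorem dilate_comp_energy (hl : 1 < l) (hV : GoodPotential l V) (hz : z ≠ 0) {f : ℝ → ℝ}
    (hf : DifferentiableAt ℝ f (energy V z)) :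
    dilate l V (fun w => f (energy V w)) z = deriv f (energy V z) := by
  have h1 := (energy_smooth hV).differentiable (by simp) z
  have := (quasiVirial_pos hl hV hz).ne'
  rw [dilate, dPos_comp hf h1, dMom_comp hf h1, dPos_energy hV, dMom_energy hV, inv_mul_eq_iff_eq_mul₀ this]
  simp only [quasiVirial]
  ring

theorem dilate_smooth (hl : 1 < l) (hV : GoodPotential l V) (hE₁ : V 0 < E₁)
    (hv : ContDiffOn ℝ (⊤ : ℕ∞) v (above V E₁)) :
    ContDiffOn ℝ (⊤ : ℕ∞) (dilate l V v) (above V E₁) :=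
  (symb_inv_quasiVirial hl hV hE₁).smooth.mul
    ((contDiff_fst.contDiffOn.mul (dPos_smooth (isOpen_above hV) hv)).add
      ((contDiff_const.mul contDiff_snd).contDiffOn.mul (dMom_smooth (isOpen_above hV) hv)))

theorem flowDeriv_dilate (hl : 1 < l) (hV : GoodPotential l V) (hE₁ : V 0 < E₁)
    (hv : ContDiffOn ℝ (⊤ : ℕ∞) v (above V E₁)) (hz : z ∈ above V E₁) :
    flowDeriv V (dilate l V v) z
      = dilate l V (flowDeriv V v) z - defect l V z * flowDeriv V v z := by
  have hU := isOpen_above (E₁ := E₁) hV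
  have hz0 : z ≠ 0 := ne_zero_of_lt_energy (hE₁.trans hz)
  have hq := (quasiVirial_pos hl hV hz0).ne'
  have dq : DifferentiableAt ℝ (quasiVirial l V) z :=
    smooth_differentiableAt hU (symb_quasiVirial hl hV hU).smooth hz
  have dqi : DifferentiableAt ℝ (fun w => (quasiVirial l V w)⁻¹) z := dq.inv hq
  have e1 : dPos (fun w => (quasiVirial l V w)⁻¹) z = _ :=
    dPos_comp (differentiableAt_inv hq) dq
  have e2 : dMom (fun w => (quasiVirial l V w)⁻¹) z = _ :=
    dMom_comp (differentiableAt_inv hq) dq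
  rw [deriv_inv, dPos_quasiVirial hV] at e1
  rw [deriv_inv, dMom_quasiVirial hV] at e2
  have dvp : DifferentiableAt ℝ (dPos v) z := smooth_differentiableAt hU (dPos_smooth hU hv) hz
  have dvm : DifferentiableAt ℝ (dMom v) z := smooth_differentiableAt hU (dMom_smooth hU hv) hz
  have h1 : DifferentiableAt ℝ (fun w : ℝ × ℝ => w.2) z := differentiableAt_snd
  have h0 : DifferentiableAt ℝ (fun w : ℝ × ℝ => w.1) z := differentiableAt_fst
  have h2 : DifferentiableAt ℝ (deriv V) z.1 := hV.smooth_deriv.differentiable (by simp) z.1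
  have h3 : DifferentiableAt ℝ (fun w : ℝ × ℝ => deriv V w.1) z := h2.comp z h0
  have comm := dPos_dMom_comm hU hv hz
  have hc : ∀ c : ℝ, DifferentiableAt ℝ (fun _ : ℝ × ℝ => c) z := fun c => differentiableAt_const c
  have eF : flowDeriv V v = fun w => 2 * w.2 * dPos v w + (-1) * deriv V w.1 * dMom v w :=
    funext fun w => by simp only [flowDeriv]; ring
  have eD : dilate l V v
      = fun w => (quasiVirial l V w)⁻¹ * (w.1 * dPos v w + l * w.2 * dMom v w) := rfl
  have p1 : dPos (dilate l V v) z = (quasiVirial l V z)⁻¹ *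
      (dPos v z + z.1 * dPos (dPos v) z + l * z.2 * dMom (dPos v) z)
      - ((quasiVirial l V z) ^ 2)⁻¹ * (deriv V z.1 + z.1 * deriv (deriv V) z.1) *
        (z.1 * dPos v z + l * z.2 * dMom v z) := by
    rw [eD, dPos_mul dqi ((h0.fun_mul dvp).fun_add ((h1.const_mul l).fun_mul dvm)), e1,
      dPos_add (h0.fun_mul dvp) ((h1.const_mul l).fun_mul dvm), dPos_mul h0 dvp,
      dPos_mul (h1.const_mul l) dvm, dPos_mul (hc l) h1, dPos_fst, dPos_snd, dPos_const, comm]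
    ring
  have p2 : dMom (dilate l V v) z = (quasiVirial l V z)⁻¹ *
      (z.1 * dMom (dPos v) z + l * dMom v z + l * z.2 * dMom (dMom v) z)
      - ((quasiVirial l V z) ^ 2)⁻¹ * (4 * l * z.2) *
        (z.1 * dPos v z + l * z.2 * dMom v z) := by
    rw [eD, dMom_mul dqi ((h0.fun_mul dvp).fun_add ((h1.const_mul l).fun_mul dvm)), e2,
      dMom_add (h0.fun_mul dvp) ((h1.const_mul l).fun_mul dvm), dMom_mul h0 dvp,
      dMom_mul (h1.const_mul l) dvm, dMom_mul (hc l) h1, dMom_fst, dMom_snd, dMom_const]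
    ring
  have p3 : dPos (flowDeriv V v) z = 2 * z.2 * dPos (dPos v) z
      - deriv (deriv V) z.1 * dMom v z - deriv V z.1 * dMom (dPos v) z := by
    rw [eF, dPos_add ((h1.const_mul 2).fun_mul dvp) ((h3.const_mul (-1)).fun_mul dvm),
      dPos_mul (h1.const_mul 2) dvp, dPos_mul (h3.const_mul (-1)) dvm, dPos_mul (hc 2) h1,
      dPos_mul (hc (-1)) h3, dPos_comp h2 h0, dPos_fst, dPos_snd, dPos_const, dPos_const, comm]
    ring
  have p4 : dMom (flowDeriv V v) z = 2 * dPos v z + 2 * z.2 * dMom (dPos v) z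
      - deriv V z.1 * dMom (dMom v) z := by
    rw [eF, dMom_add ((h1.const_mul 2).fun_mul dvp) ((h3.const_mul (-1)).fun_mul dvm),
      dMom_mul (h1.const_mul 2) dvp, dMom_mul (h3.const_mul (-1)) dvm, dMom_mul (hc 2) h1,
      dMom_mul (hc (-1)) h3, dMom_comp h2 h0, dMom_fst, dMom_snd, dMom_const, dMom_const]
    ring
  rw [flowDeriv, p1, p2, dilate, p3, p4, defect, flowDeriv]
  have eq : quasiVirial l V z = z.1 * deriv V z.1 + 2 * l * z.2 ^ 2 := rfl
  generalize quasiVirial l V z = Q at *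
  generalize deriv V z.1 = V1 at *
  generalize deriv (deriv V) z.1 = V2 at *
  field_simp
  rw [eq]
  ring

end Dilation

theorem rpow_le_of_comparable {a b K : ℝ} (ha : 0 < a) (hb : 0 < b) (hK : 0 < K) (h1 : a ≤ K * b)
    (h2 : b ≤ K * a) (s : ℝ) : a ^ s ≤ K ^ |s| * b ^ s := by
  rcases le_total 0 s with hs | hs
  · rw [abs_of_nonneg hs, ← Real.mul_rpow hK.le hb.le]
    exact Real.rpow_le_rpow ha.le h1 hs
  · rw [abs_of_nonpos hs, Real.rpow_neg hK.le, ← Real.inv_rpow hK.le,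
      ← Real.mul_rpow (inv_pos.2 hK).le hb.le]
    refine Real.rpow_le_rpow_of_nonpos (by positivity) ?_ hs
    rwa [inv_mul_le_iff₀ hK]

section Average

variable {l : ℝ} {V : ℝ → ℝ} {E₁ E : ℝ} {g h p : ℝ × ℝ → ℝ} {z : ℝ × ℝ} {a b n : ℝ}

theorem sub_energy_le (hl : 1 < l) (hV : GoodPotential l V) :
    ∃ C, 0 < C ∧ ∀ z, energy V z - V 0 ≤ C * lam l z.1 z.2 ^ (2 * l) := by
  obtain ⟨C, hC, h⟩ := hV.energy_le hl
  refine ⟨C + |V 0|, by positivity, fun z => ?_⟩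
  have h1 : 1 ≤ lam l z.1 z.2 ^ (2 * l) :=
    Real.one_le_rpow (one_le_lam (by linarith) _ _) (by linarith)
  nlinarith [le_abs_self (energy V z), h z, neg_abs_le (V 0), abs_nonneg (V 0)]

/-- The weight is constant along the orbits, up to a bounded factor. -/
theorem wt_comparable (hl : 1 < l) (hV : GoodPotential l V) (hE₁ : V 0 < E₁) (n : ℝ) :
    ∃ K, 0 < K ∧ ∀ z ∈ above V E₁, ∀ w, energy V w = energy V z → wt l n 0 w ≤ K * wt l n 0 z := by
  obtain ⟨c, hc, h⟩ := hV.elliptic hl hE₁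
  obtain ⟨M, hM, h'⟩ := sub_energy_le hl hV
  have h0 : 0 < l := by linarith
  refine ⟨(M / c) ^ |n / (2 * l)|, by positivity, fun z hz w hw => ?_⟩
  have key : ∀ z w : ℝ × ℝ, z ∈ above V E₁ → energy V w = energy V z →
      lam l z.1 z.2 ^ (2 * l) ≤ M / c * lam l w.1 w.2 ^ (2 * l) := fun z w hz hw => by
    have h1 := (h z hz).2
    have h2 := h' w
    rw [hw] at h2
    rw [div_mul_eq_mul_div, le_div_iff₀ hc]
    linarith
  have hw' : w ∈ above V E₁ := by
    change E₁ < energy V w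
    rw [hw]; exact hz
  have := rpow_le_of_comparable (Real.rpow_pos_of_pos (lam_pos h0 w.1 w.2) (2 * l))
    (Real.rpow_pos_of_pos (lam_pos h0 z.1 z.2) (2 * l)) (by positivity) (key w z hw' hw.symm)
    (key z w hz hw) (n / (2 * l))
  rw [← Real.rpow_mul (lam_pos h0 _ _).le, ← Real.rpow_mul (lam_pos h0 _ _).le,
    mul_div_cancel₀ _ (by positivity)] at this
  simpa [wt] using this

theorem dilate_congr {U : Set (ℝ × ℝ)} (hU : IsOpen U) (e : Set.EqOn g h U) :
    Set.EqOn (dilate l V g) (dilate l V h) U := fun z hz => by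
  rw [dilate, dilate, dPos_congr hU e hz, dMom_congr hU e hz]

theorem dilate_add (hg : DifferentiableAt ℝ g z) (hh : DifferentiableAt ℝ h z) :
    dilate l V (fun w => g w + h w) z = dilate l V g z + dilate l V h z := by
  rw [dilate, dilate, dilate, dPos_add hg hh, dMom_add hg hh]
  ring

theorem mean_differentiableAt (hl : 1 < l) (hV : GoodPotential l V) (hE₁ : V 0 < E₁)
    (hp : ContDiffOn ℝ (⊤ : ℕ∞) p (above V E₁)) (hE : E₁ < E) :
    DifferentiableAt ℝ (mean V p) E :=
  ((mean_smooth hl hV hE₁.le hp).contDiffAt (Ioi_mem_nhds hE)).differentiableAt (by simp)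

theorem mean_energy_smooth (hl : 1 < l) (hV : GoodPotential l V) (hE₁ : V 0 < E₁)
    (hp : ContDiffOn ℝ (⊤ : ℕ∞) p (above V E₁)) :
    ContDiffOn ℝ (⊤ : ℕ∞) (fun z => mean V p (energy V z)) (above V E₁) :=
  (mean_smooth hl hV hE₁.le hp).comp (energy_smooth hV).contDiffOn fun _ hz => hz

theorem dilate_flowDeriv_flowPrim (hl : 1 < l) (hV : GoodPotential l V) (hE₁ : V 0 < E₁)
    (hp : ContDiffOn ℝ (⊤ : ℕ∞) p (above V E₁)) (hz : z ∈ above V E₁) :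
    dilate l V (flowDeriv V (flowPrim V p)) z = dilate l V p z - deriv (mean V p) (energy V z) := by
  have hU := isOpen_above (E₁ := E₁) hV
  have e : Set.EqOn (flowDeriv V (flowPrim V p))
      (fun w => p w + (fun E => -mean V p E) (energy V w)) (above V E₁) := fun w hw => by
    rw [flowDeriv_flowPrim hl hV hE₁.le hp hw, sub_eq_add_neg]
  have hm : DifferentiableAt ℝ (fun E => -mean V p E) (energy V z) :=
    (mean_differentiableAt hl hV hE₁ hp hz).neg
  have hmz : DifferentiableAt ℝ (fun w => (fun E => -mean V p E) (energy V w)) z :=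
    hm.comp z ((energy_smooth hV).differentiable (by simp) z)
  rw [dilate_congr hU e hz, dilate_add (smooth_differentiableAt hU hp hz) hmz, dilate_comp_energy hl hV
      (ne_zero_of_lt_energy (hE₁.trans hz)) hm, deriv.fun_neg, sub_eq_add_neg]

theorem deriv_mean (hl : 1 < l) (hV : GoodPotential l V) (hE₁ : V 0 < E₁)
    (hp : ContDiffOn ℝ (⊤ : ℕ∞) p (above V E₁)) (hE : E₁ < E) :
    deriv (mean V p) E = mean V (fun z => dilate l V p z - defect l V z * p z) E
      + mean V (defect l V) E * mean V p E := by
  have hU := isOpen_above (E₁ := E₁) hV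
  have hu := flowPrim_smooth hl hV hE₁.le hp
  have h1 := mean_flowDeriv hl hV hE₁.le hE (dilate_smooth hl hV hE₁ hu)
  have hd := (symb_defect hl hV hE₁).smooth
  have e : ∀ z, energy V z = E → flowDeriv V (dilate l V (flowPrim V p)) z
      = (dilate l V p z - defect l V z * p z)
        + (mean V p E * defect l V z + -deriv (mean V p) E * 1) := fun z hz => by
    have hz' : z ∈ above V E₁ := by change E₁ < energy V z; rwa [hz]
    rw [flowDeriv_dilate hl hV hE₁ hu hz', dilate_flowDeriv_flowPrim hl hV hE₁ hp hz',
      flowDeriv_flowPrim hl hV hE₁.le hp hz', hz]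
    ring
  rw [mean_congr hl hV (hE₁.trans hE) e, mean_add hl hV hE₁.le hE
    ((dilate_smooth hl hV hE₁ hp).sub (hd.mul hp))
    ((contDiffOn_const.mul hd).add contDiffOn_const), mean_add hl hV hE₁.le hE
    (contDiffOn_const.mul hd) contDiffOn_const, mean_const_mul, mean_const_mul,
    mean_one hl hV (hE₁.trans hE)] at h1
  linarith

theorem symB_mean (hl : 1 < l) (hV : GoodPotential l V) (hE₁ : V 0 < E₁) (k : ℕ) :
    ∀ {n : ℝ} {p : ℝ × ℝ → ℝ}, Symb l (above V E₁) n 0 p →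
      SymB l (above V E₁) k n 0 (fun z => mean V p (energy V z)) := by
  have h0 : 0 < l := by linarith
  have hU := isOpen_above (E₁ := E₁) hV
  have key : ∀ {n : ℝ} {p : ℝ × ℝ → ℝ}, Symb l (above V E₁) n 0 p →
      ∃ C, ∀ z ∈ above V E₁, |mean V p (energy V z)| ≤ C * wt l n 0 z := fun {n p} hp => by
    obtain ⟨C, hC⟩ := (hp.bound 0).bound
    obtain ⟨K, hK, h⟩ := wt_comparable hl hV hE₁ n
    refine ⟨|C| * K, fun z hz => abs_mean_le hl hV (hE₁.trans hz) fun θ => ?_⟩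
    refine (hC _ (orbit_mem_above hl hV one_pos one_pos hE₁.le hz θ)).trans ?_
    rw [mul_assoc]
    exact mul_le_mul (le_abs_self C) (h z hz _ (energy_orbit hl hV one_pos one_pos
      (hE₁.trans hz) θ)) (wt_pos h0 _ _ _).le (abs_nonneg C)
  induction k with
  | zero => exact key
  | succ k ih =>
    intro n p hp
    have hA : SymB l (above V E₁) k (n - 2 * l) 0 (fun z => deriv (mean V p) (energy V z)) := by
      have hd := symb_defect hl hV hE₁
      have hq : Symb l (above V E₁) (n - 2 * l) 0
          (fun z => dilate l V p z - defect l V z * p z) :=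
        (symb_dilate hl hV hE₁ hp).sub h0 hU ((hd.mul h0 hU hp).weaken h0 (by linarith)
          (by linarith))
      have s1 := mean_energy_smooth hl hV hE₁ hq.smooth
      have s2 := mean_energy_smooth hl hV hE₁ hd.smooth
      have s3 := mean_energy_smooth hl hV hE₁ hp.smooth
      refine ((ih hq).add hU s1 (s2.mul s3) (((ih hd).mul h0 hU s2 s3 (ih hp)).weaken h0
        (by linarith) (by linarith))).congr hU fun z hz => ?_
      exact (deriv_mean hl hV hE₁ hp.smooth hz).symm
    have hAs : ContDiffOn ℝ (⊤ : ℕ∞) (fun z => deriv (mean V p) (energy V z)) (above V E₁) :=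
      ((mean_smooth hl hV hE₁.le hp.smooth).deriv_of_isOpen isOpen_Ioi (m := (⊤ : ℕ∞))
        (by simp)).comp (energy_smooth hV).contDiffOn fun _ hz => hz
    have hf : Symb l (above V E₁) 0 (2 * l - 1) (fun z => deriv V z.1) := symb_force hV
    have hm : Symb l (above V E₁) l 0 (fun z => 2 * z.2) := (Symb.mom h0).const_mul h0 hU 2
    have hdE := fun z => (energy_smooth hV).differentiable (by simp) z
    refine ⟨key hp, ?_, ?_⟩
    · refine ((hA.mul h0 hU hAs hf.smooth (hf.bound k)).weaken h0 (by linarith)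
        (by linarith)).congr hU fun z hz => ?_
      rw [dPos_comp (mean_differentiableAt hl hV hE₁ hp.smooth hz) (hdE z), dPos_energy hV]
    · refine ((hA.mul h0 hU hAs hm.smooth (hm.bound k)).weaken h0 (by linarith)
        (by linarith)).congr hU fun z hz => ?_
      rw [dMom_comp (mean_differentiableAt hl hV hE₁ hp.smooth hz) (hdE z), dMom_energy hV]

theorem symb_mean (hl : 1 < l) (hV : GoodPotential l V) (hE₁ : V 0 < E₁)
    (hp : Symb l (above V E₁) n 0 p) :
    Symb l (above V E₁) n 0 (fun z => mean V p (energy V z)) :=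
  ⟨mean_energy_smooth hl hV hE₁ hp.smooth, fun k => symB_mean hl hV hE₁ k hp⟩

end Average

section Solution

variable {l : ℝ} {V : ℝ → ℝ} {E₁ : ℝ} {u : ℝ × ℝ → ℝ} {z : ℝ × ℝ} {n : ℝ}

theorem clock_le (hl : 1 < l) (hV : GoodPotential l V) (hE₁ : V 0 < E₁) :
    ∃ C, 0 < C ∧ ∀ z ∈ above V E₁, ∀ θ, clock V (lam l z.1 z.2) (lam l z.1 z.2 ^ l) (energy V z) θ
      ≤ C * lam l z.1 z.2 ^ (1 - l) := by
  have h0 : 0 < l := by linarith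
  obtain ⟨c, hc, he⟩ := hV.elliptic hl hE₁
  obtain ⟨K₁, hK₁, h1⟩ := wt_comparable hl hV hE₁ 1
  obtain ⟨K₂, hK₂, h2⟩ := wt_comparable hl hV hE₁ l
  obtain ⟨K₃, hK₃, h3⟩ := wt_comparable hl hV hE₁ (2 * l)
  simp only [wt, Real.rpow_zero, mul_one, Real.rpow_one] at h1 h2 h3
  refine ⟨(K₁ ^ 2 + K₂ ^ 2) * (K₃ / c), by positivity, fun z hz θ => ?_⟩
  have hΛ := lam_pos h0 z.1 z.2
  set Λ := lam l z.1 z.2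
  have hB : 0 < Λ ^ l := Real.rpow_pos_of_pos hΛ l
  have hE : V 0 < energy V z := hE₁.trans hz
  have hw := energy_orbit hl hV hΛ hB hE θ
  have hwU : orbit V Λ (Λ ^ l) (energy V z) θ ∈ above V E₁ :=
    orbit_mem_above hl hV hΛ hB hE₁.le hz θ
  have hvp := virial_orbit_pos hl hV hΛ hB hE θ
  rw [clock]
  set r := radius V Λ (Λ ^ l) θ (energy V z) with hr
  have w1 : (orbit V Λ (Λ ^ l) (energy V z) θ).1 = r * (Λ * sin θ) := rfl
  have w2 : (orbit V Λ (Λ ^ l) (energy V z) θ).2 = r * (Λ ^ l * cos θ) := rfl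
  set w := orbit V Λ (Λ ^ l) (energy V z) θ
  have b1 : |r * sin θ| ≤ K₁ := by
    have := (abs_le_lam h0 w.1 w.2).trans (h1 z hz w hw)
    rw [w1, mul_left_comm, abs_mul, abs_of_pos hΛ, mul_comm K₁] at this
    exact le_of_mul_le_mul_left this hΛ
  have b2 : |r * cos θ| ≤ K₂ := by
    have := (abs_le_lam_rpow h0 w.1 w.2).trans (h2 z hz w hw)
    rw [w2, mul_left_comm, abs_mul, abs_of_pos hB, mul_comm K₂] at this
    exact le_of_mul_le_mul_left this hB
  have b3 : r ^ 2 ≤ K₁ ^ 2 + K₂ ^ 2 := by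
    have e : r ^ 2 = (r * sin θ) ^ 2 + (r * cos θ) ^ 2 := by
      linear_combination -r ^ 2 * sin_sq_add_cos_sq θ
    rw [e]
    exact add_le_add (sq_le_sq' (abs_le.1 b1).1 (abs_le.1 b1).2)
      (sq_le_sq' (abs_le.1 b2).1 (abs_le.1 b2).2)
  have b4 : Λ ^ (2 * l) ≤ K₃ / c * virial V w := by
    refine (h3 w hwU z hw.symm).trans ?_
    rw [div_mul_eq_mul_div, le_div_iff₀ hc, mul_assoc]
    refine mul_le_mul_of_nonneg_left ?_ hK₃.le
    rw [mul_comm]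
    exact (he w hwU).1
  rw [div_le_iff₀ hvp]
  have e : Λ * Λ ^ l = Λ ^ (1 - l) * Λ ^ (2 * l) := by
    rw [← Real.rpow_add hΛ, show 1 - l + 2 * l = 1 + l by ring, Real.rpow_add hΛ, Real.rpow_one]
  calc r ^ 2 * (Λ * Λ ^ l) ≤ (K₁ ^ 2 + K₂ ^ 2) * (Λ ^ (1 - l) * (K₃ / c * virial V w)) := by
        rw [e]; gcongr
    _ = _ := by ring

theorem abs_le_of_flowDeriv_le (hl : 1 < l) (hV : GoodPotential l V) (hE₁ : V 0 < E₁)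
    (hu : ContDiffOn ℝ (⊤ : ℕ∞) u (above V E₁))
    (hg : ∃ C, ∀ z ∈ above V E₁, |flowDeriv V u z| ≤ C * wt l n 0 z)
    (h0 : ∀ ξ, 0 < ξ → ((0 : ℝ), ξ) ∈ above V E₁ → u (0, ξ) = 0) :
    ∃ C, ∀ z ∈ above V E₁, |u z| ≤ C * wt l (n - l + 1) 0 z := by
  have hl0 : 0 < l := by linarith
  have hU := isOpen_above (E₁ := E₁) hV
  obtain ⟨C, hC⟩ := hg
  obtain ⟨C₁, hC₁, hclock⟩ := clock_le hl hV hE₁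
  obtain ⟨K, hK, hcomp⟩ := wt_comparable hl hV hE₁ n
  refine ⟨C₁ * (|C| * K) * π, fun z hz => ?_⟩
  have hE : V 0 < energy V z := hE₁.trans hz
  have hΛ := lam_pos hl0 z.1 z.2
  have hB : 0 < lam l z.1 z.2 ^ l := Real.rpow_pos_of_pos hΛ l
  have hcl := hclock z hz
  have hw : wt l (n - l + 1) 0 z = lam l z.1 z.2 ^ (1 - l) * wt l n 0 z := by
    simp only [wt, Real.rpow_zero, mul_one]
    rw [← Real.rpow_add hΛ]
    congr 1
    ring
  obtain ⟨θ, hθ, hzθ⟩ := exists_orbit hl hV hΛ hB (ne_zero_of_lt_energy hE)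
  set Λ := lam l z.1 z.2
  have horb := fun t => orbit_mem_above hl hV hΛ hB hE₁.le hz t
  have hΛl : 0 < Λ ^ (1 - l) := Real.rpow_pos_of_pos hΛ _
  have hmv := convex_univ.norm_image_sub_le_of_norm_hasDerivWithin_le (𝕜 := ℝ)
    (f := fun t => u (orbit V Λ (Λ ^ l) (energy V z) t)) (x := 0) (y := θ)
    (C := C₁ * Λ ^ (1 - l) * (|C| * (K * wt l n 0 z)))
    (fun t _ => (comp_orbit_hasDerivAt hl hV hΛ hB hE t
      (smooth_differentiableAt hU hu (horb t))).hasDerivWithinAt)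
    (fun t _ => by
      have hp := clock_pos hl hV hΛ hB hE t
      rw [norm_mul, Real.norm_eq_abs, Real.norm_eq_abs, abs_of_pos hp]
      refine mul_le_mul (hcl t) ((hC _ (horb t)).trans ?_) (abs_nonneg _) (by positivity)
      exact mul_le_mul (le_abs_self C) (hcomp z hz _ (energy_orbit hl hV hΛ hB hE t))
        (wt_pos hl0 _ _ _).le (abs_nonneg C)) (Set.mem_univ _) (Set.mem_univ _)
  have h1 : u (orbit V Λ (Λ ^ l) (energy V z) 0) = 0 := by
    have e : orbit V Λ (Λ ^ l) (energy V z) 0 = (0, radius V Λ (Λ ^ l) 0 (energy V z) * Λ ^ l) := by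
      simp [orbit, rayPoint]
    have hm := horb 0
    rw [e] at hm ⊢
    exact h0 _ (mul_pos (radius_pos hl hV hΛ hB hE 0) hB) hm
  simp only [← hzθ, h1, sub_zero, Real.norm_eq_abs] at hmv
  refine hmv.trans ?_
  have hθ' : |θ| ≤ π := abs_le.2 ⟨hθ.1.le, hθ.2⟩
  have hwp := wt_pos hl0 n 0 z
  calc C₁ * Λ ^ (1 - l) * (|C| * (K * wt l n 0 z)) * |θ|
      ≤ C₁ * Λ ^ (1 - l) * (|C| * (K * wt l n 0 z)) * π :=
        mul_le_mul_of_nonneg_left hθ' (by positivity)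
    _ = _ := by rw [hw]; ring

theorem symb_flowDeriv_dilate (hl : 1 < l) (hV : GoodPotential l V) (hE₁ : V 0 < E₁)
    (hu : ContDiffOn ℝ (⊤ : ℕ∞) u (above V E₁)) (hg : Symb l (above V E₁) n 0 (flowDeriv V u)) :
    Symb l (above V E₁) (n - 2 * l) 0 (flowDeriv V (dilate l V u)) := by
  have hl0 : 0 < l := by linarith
  have hU := isOpen_above (E₁ := E₁) hV
  refine ((symb_dilate hl hV hE₁ hg).sub hl0 hU (((symb_defect hl hV hE₁).mul hl0 hU hg).weaken hl0
    (by linarith) (by linarith))).congr hU fun z hz => ?_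
  exact (flowDeriv_dilate hl hV hE₁ hu hz).symm

theorem dilate_axis (hV : GoodPotential l V)
    (hu : ContDiffOn ℝ (⊤ : ℕ∞) u (above V E₁))
    (h0 : ∀ ξ, 0 < ξ → ((0 : ℝ), ξ) ∈ above V E₁ → u (0, ξ) = 0) {ξ : ℝ} (hξ : 0 < ξ)
    (hz : ((0 : ℝ), ξ) ∈ above V E₁) : dilate l V u (0, ξ) = 0 := by
  have hU := isOpen_above (E₁ := E₁) hV
  have h1 : dMom u (0, ξ) = 0 := by
    rw [← (deriv_mom_eq (smooth_differentiableAt hU hu hz)).deriv]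
    have : (fun ξ' => u (0, ξ')) =ᶠ[nhds ξ] fun _ => 0 := by
      filter_upwards [lt_mem_nhds hξ, (Continuous.prodMk_right (0 : ℝ)).continuousAt.eventually
        (hU.mem_nhds hz)] with ξ' h h' using h0 ξ' h h'
    rw [this.deriv_eq, deriv_const]
  simp [dilate, h1]

/-- The two partial derivatives of a solution of the flow equation, in terms of its dilation
derivative. -/
theorem symB_partials (hl : 1 < l) (hV : GoodPotential l V) (hE₁ : V 0 < E₁) {k : ℕ}
    (hu : ContDiffOn ℝ (⊤ : ℕ∞) u (above V E₁)) (hg : Symb l (above V E₁) n 0 (flowDeriv V u))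
    (hD : SymB l (above V E₁) k (n - 2 * l - l + 1) 0 (dilate l V u)) :
    SymB l (above V E₁) k (n - l) 0 (dPos u) ∧ SymB l (above V E₁) k (n - l + 1 - l) 0 (dMom u) := by
  have hl0 : 0 < l := by linarith
  have hU := isOpen_above (E₁ := E₁) hV
  have hq := symb_inv_quasiVirial hl hV hE₁
  have hDs := dilate_smooth hl hV hE₁ hu
  have hf : Symb l (above V E₁) 0 (2 * l - 1) (fun z => deriv V z.1) := symb_force hV
  have hm : ∀ c : ℝ, Symb l (above V E₁) l 0 (fun z => c * z.2) := fun c =>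
    (Symb.mom hl0).const_mul hl0 hU c
  have hx : Symb l (above V E₁) 0 1 (fun z => z.1) := Symb.pos
  have hz0 : ∀ z ∈ above V E₁, z ≠ 0 := fun z hz => ne_zero_of_lt_energy (hE₁.trans hz)
  constructor
  · have s1 := hq.mul hl0 hU ((hm l).mul hl0 hU hg)
    have s2 := (hf.bound k).mul hl0 hU hf.smooth hDs hD
    exact (((s1.weaken hl0 (a' := n - l) (b' := 0) (by linarith) (by linarith)).bound k).add hU
      s1.smooth (hf.smooth.mul hDs) (s2.weaken hl0 (by linarith) (by linarith))).congr hU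
      fun z hz => (dPos_eq hl hV (hz0 z hz)).symm
  · have s1 := (hq.mul hl0 hU (hx.mul hl0 hU hg)).const_mul hl0 hU (-1)
    have s2 := ((hm 2).bound k).mul hl0 hU (hm 2).smooth hDs hD
    exact ((s2.weaken hl0 (a' := n - l + 1 - l) (b' := 0) (by linarith) (by linarith)).add hU
      ((hm 2).smooth.mul hDs) s1.smooth
      ((s1.weaken hl0 (by linarith) (by linarith)).bound k)).congr hU
      fun z hz => by rw [dMom_eq hl hV (hz0 z hz)]; ring

theorem symB_solution (hl : 1 < l) (hV : GoodPotential l V) (hE₁ : V 0 < E₁) (k : ℕ) :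
    ∀ {n : ℝ} {u : ℝ × ℝ → ℝ}, ContDiffOn ℝ (⊤ : ℕ∞) u (above V E₁) →
      Symb l (above V E₁) n 0 (flowDeriv V u) →
      (∀ ξ, 0 < ξ → ((0 : ℝ), ξ) ∈ above V E₁ → u (0, ξ) = 0) →
      SymB l (above V E₁) k (n - l + 1) 0 u := by
  have hl0 : 0 < l := by linarith
  induction k with
  | zero => exact fun hu hg h0 => abs_le_of_flowDeriv_le hl hV hE₁ hu (hg.bound 0).bound h0
  | succ k ih =>
    intro n u hu hg h0
    have h1 := symB_partials hl hV hE₁ hu hg (ih (dilate_smooth hl hV hE₁ hu)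
      (symb_flowDeriv_dilate hl hV hE₁ hu hg) fun ξ hξ hz => dilate_axis hV hu h0 hξ hz)
    exact ⟨abs_le_of_flowDeriv_le hl hV hE₁ hu (hg.bound 0).bound h0,
      h1.1.weaken hl0 (by linarith) (by linarith), h1.2⟩

theorem symb_solution (hl : 1 < l) (hV : GoodPotential l V) (hE₁ : V 0 < E₁)
    (hu : ContDiffOn ℝ (⊤ : ℕ∞) u (above V E₁)) (hg : Symb l (above V E₁) n 0 (flowDeriv V u))
    (h0 : ∀ ξ, 0 < ξ → ((0 : ℝ), ξ) ∈ above V E₁ → u (0, ξ) = 0) :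
    Symb l (above V E₁) (n - l + 1) 0 u ∧ Symb l (above V E₁) (n - l) 0 (dPos u) :=
  ⟨⟨hu, fun k => symB_solution hl hV hE₁ k hu hg h0⟩, dPos_smooth (isOpen_above hV) hu, fun k =>
    (symB_partials hl hV hE₁ hu hg (symB_solution hl hV hE₁ k (dilate_smooth hl hV hE₁ hu)
      (symb_flowDeriv_dilate hl hV hE₁ hu hg) fun _ hξ hz => dilate_axis hV hu h0 hξ hz)).1⟩

theorem symb_flowPrim (hl : 1 < l) (hV : GoodPotential l V) (hE₁ : V 0 < E₁) {p : ℝ × ℝ → ℝ}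
    (hp : Symb l (above V E₁) n 0 p) : Symb l (above V E₁) (n - l + 1) 0 (flowPrim V p) ∧
      Symb l (above V E₁) (n - l) 0 (dPos (flowPrim V p)) :=
  symb_solution hl hV hE₁ (flowPrim_smooth hl hV hE₁.le hp.smooth)
    ((hp.sub (zero_lt_one.trans hl) (isOpen_above hV) (symb_mean hl hV hE₁ hp)).congr
      (isOpen_above hV) fun _ hz => (flowDeriv_flowPrim hl hV hE₁.le hp.smooth hz).symm)
    fun _ hξ hz => flowPrim_axis hl hV hE₁.le hp.smooth hξ hz

end Solution

section ChangeOfVariables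

variable {l : ℝ} {V : ℝ → ℝ} {E : ℝ}

theorem radius_congr (hl : 1 < l) (hV : GoodPotential l V) (hE : V 0 < E) {θ φ : ℝ}
    (h : ∀ r, energy V (rayPoint 1 1 θ r) = energy V (rayPoint 1 1 φ r)) :
    radius V 1 1 θ E = radius V 1 1 φ E :=
  radius_unique hl hV one_pos one_pos hE φ (radius_pos hl hV one_pos one_pos hE θ)
    (by rw [← h]; exact energy_orbit hl hV one_pos one_pos hE θ)

theorem radius_pi_sub (hl : 1 < l) (hV : GoodPotential l V) (hE : V 0 < E) (θ : ℝ) :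
    radius V 1 1 (π - θ) E = radius V 1 1 θ E :=
  radius_congr hl hV hE fun r => by simp [energy, rayPoint, cos_pi_sub, sin_pi_sub]

theorem radius_neg (hl : 1 < l) (hV : GoodPotential l V) (hE : V 0 < E) (θ : ℝ) :
    radius V 1 1 (-θ) E = radius V 1 1 θ E :=
  radius_congr hl hV hE fun r => by simp [energy, rayPoint, hV.even]

theorem orbit_pi_sub (hl : 1 < l) (hV : GoodPotential l V) (hE : V 0 < E) (θ : ℝ) :
    orbit V 1 1 E (π - θ) = ((orbit V 1 1 E θ).1, -(orbit V 1 1 E θ).2) := by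
  simp [orbit, rayPoint, radius_pi_sub hl hV hE, cos_pi_sub, sin_pi_sub]

theorem orbit_neg (hl : 1 < l) (hV : GoodPotential l V) (hE : V 0 < E) (θ : ℝ) :
    orbit V 1 1 E (-θ) = (-(orbit V 1 1 E θ).1, (orbit V 1 1 E θ).2) := by
  simp [orbit, rayPoint, radius_neg hl hV hE]

theorem clock_pi_sub (hl : 1 < l) (hV : GoodPotential l V) (hE : V 0 < E) (θ : ℝ) :
    clock V 1 1 E (π - θ) = clock V 1 1 E θ := by
  simp [clock, virial, radius_pi_sub hl hV hE, orbit_pi_sub hl hV hE]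

theorem clock_neg (hl : 1 < l) (hV : GoodPotential l V) (hE : V 0 < E) (θ : ℝ) :
    clock V 1 1 E (-θ) = clock V 1 1 E θ := by
  simp [clock, virial, radius_neg hl hV hE, orbit_neg hl hV hE, hV.deriv_neg]

theorem sqrt_sub_orbit (hl : 1 < l) (hV : GoodPotential l V) (hE : V 0 < E) {θ : ℝ}
    (hθ : θ ∈ Set.Icc (-(π / 2)) (π / 2)) :
    √(E - V (orbit V 1 1 E θ).1) = (orbit V 1 1 E θ).2 := by
  have h := energy_orbit hl hV one_pos one_pos hE θ
  rw [energy] at h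
  rw [show E - V (orbit V 1 1 E θ).1 = (orbit V 1 1 E θ).2 ^ 2 by linarith]
  refine Real.sqrt_sq (mul_nonneg (radius_pos hl hV one_pos one_pos hE θ).le ?_)
  simpa using cos_nonneg_of_mem_Icc hθ

theorem orbit_snd_pos (hl : 1 < l) (hV : GoodPotential l V) (hE : V 0 < E) {θ : ℝ}
    (hθ : θ ∈ Set.Ioo (-(π / 2)) (π / 2)) : 0 < (orbit V 1 1 E θ).2 :=
  mul_pos (radius_pos hl hV one_pos one_pos hE θ) (by simpa using cos_pos_of_mem_Ioo hθ)

/-- Along an arc of nonnegative momentum the position can be used as a coordinate. -/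
theorem integral_position_eq (hl : 1 < l) (hV : GoodPotential l V) (hE : V 0 < E) {a b : ℝ}
    (ha : -(π / 2) ≤ a) (hab : a ≤ b) (hb : b ≤ π / 2) (f : ℝ → ℝ) :
    ∫ q in (orbit V 1 1 E a).1..(orbit V 1 1 E b).1, f q / √(E - V q)
      = 2 * ∫ θ in a..b, clock V 1 1 E θ * f (orbit V 1 1 E θ).1 := by
  have hd : ∀ θ, HasDerivAt (fun t => (orbit V 1 1 E t).1)
      (clock V 1 1 E θ * (2 * (orbit V 1 1 E θ).2)) θ := fun θ =>
    (hasFDerivAt_fst (𝕜 := ℝ) (p := orbit V 1 1 E θ)).comp_hasDerivAt θ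
      (orbit_hasDerivAt hl hV one_pos one_pos hE θ)
  have hin : ∀ θ ∈ Set.Ioo a b, θ ∈ Set.Ioo (-(π / 2)) (π / 2) := fun θ h =>
    ⟨ha.trans_lt h.1, h.2.trans_le hb⟩
  have hc : ContinuousOn (fun t => (orbit V 1 1 E t).1) (Set.Icc a b) :=
    fun θ _ => (hd θ).continuousAt.continuousWithinAt
  have h0 : ∀ θ ∈ Set.Ioo a b, 0 ≤ clock V 1 1 E θ * (2 * (orbit V 1 1 E θ).2) := fun θ h =>
    mul_nonneg (clock_pos hl hV one_pos one_pos hE θ).le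
      (mul_nonneg two_pos.le (orbit_snd_pos hl hV hE (hin θ h)).le)
  have hmono : (orbit V 1 1 E a).1 ≤ (orbit V 1 1 E b).1 := by
    refine monotoneOn_of_deriv_nonneg (convex_Icc a b) hc
      (fun θ _ => (hd θ).differentiableAt.differentiableWithinAt) (fun θ h => ?_)
      (Set.left_mem_Icc.2 hab) (Set.right_mem_Icc.2 hab) hab
    rw [interior_Icc] at h
    rw [(hd θ).deriv]
    exact h0 θ h
  rw [intervalIntegral.integral_of_le hmono, ← integral_Icc_eq_integral_Ioc,
    ← intervalIntegral.integral_const_mul, intervalIntegral.integral_of_le hab,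
    ← integral_Icc_eq_integral_Ioc]
  have := integral_Icc_deriv_smul_of_deriv_nonneg (g := fun q => f q / √(E - V q)) hc
    (fun θ _ => hd θ) h0 hab
  rw [← this, integral_Icc_eq_integral_Ioo, integral_Icc_eq_integral_Ioo]
  refine setIntegral_congr_fun measurableSet_Ioo fun θ h => ?_
  have h1 := orbit_snd_pos hl hV hE (hin θ h)
  simp only [smul_eq_mul]
  rw [sqrt_sub_orbit hl hV hE (Set.Ioo_subset_Icc_self (hin θ h))]
  field_simp

theorem orbit_pi_div_two (hl : 1 < l) (hV : GoodPotential l V) {qM : ℝ → ℝ}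
    (hq : IsTurningPoint V qM) (hE : V 0 < E) : (orbit V 1 1 E (π / 2)).1 = qM E := by
  have h := energy_orbit hl hV one_pos one_pos hE (π / 2)
  simp only [energy, orbit, rayPoint, cos_pi_div_two, sin_pi_div_two] at h ⊢
  refine (hq E hE).2.2 _ ?_ (by simpa using h)
  simpa using radius_pos hl hV one_pos one_pos hE (π / 2)

theorem orbit_neg_pi_div_two (hl : 1 < l) (hV : GoodPotential l V) {qM : ℝ → ℝ}
    (hq : IsTurningPoint V qM) (hE : V 0 < E) : (orbit V 1 1 E (-(π / 2))).1 = -qM E := by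
  rw [orbit_neg hl hV hE, orbit_pi_div_two hl hV hq hE]

theorem orbitInt_eq (hl : 1 < l) (hV : GoodPotential l V) (hE : V 0 < E) {g : ℝ × ℝ → ℝ}
    (hg : Continuous fun t => g (orbit V 1 1 E t)) :
    orbitInt V g E = ∫ θ in -(π / 2)..π / 2, clock V 1 1 E θ *
      (g (orbit V 1 1 E θ) + g ((orbit V 1 1 E θ).1, -(orbit V 1 1 E θ).2)) := by
  have hc := continuous_clock hl hV hE
  have hper : Function.Periodic (fun θ => clock V 1 1 E θ * g (orbit V 1 1 E θ)) (2 * π) :=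
    fun θ => by simp only [clock_add_two_pi, orbit_add_two_pi]
  have hcg : Continuous fun θ => clock V 1 1 E θ * g (orbit V 1 1 E θ) := hc.mul hg
  have hcr : Continuous fun θ => clock V 1 1 E (π - θ) * g (orbit V 1 1 E (π - θ)) :=
    hcg.comp (continuous_sub_left π)
  have hrefl : ∀ θ, clock V 1 1 E θ * g ((orbit V 1 1 E θ).1, -(orbit V 1 1 E θ).2)
      = clock V 1 1 E (π - θ) * g (orbit V 1 1 E (π - θ)) := fun θ => by
    rw [clock_pi_sub hl hV hE, orbit_pi_sub hl hV hE]
  have h1 := hper.intervalIntegral_add_eq 0 (-(π / 2))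
  simp only [mul_add, hrefl]
  rw [intervalIntegral.integral_add (hcg.intervalIntegrable _ _)
    (hcr.intervalIntegrable _ _),
    intervalIntegral.integral_comp_sub_left
      (fun θ => clock V 1 1 E θ * g (orbit V 1 1 E θ)) π, show π - -(π / 2) = -(π / 2) + 2 * π by ring,
    show π - π / 2 = π / 2 by ring,
    intervalIntegral.integral_add_adjacent_intervals (hcg.intervalIntegrable _ _)
      (hcg.intervalIntegrable _ _), ← h1, zero_add, orbitInt]

theorem period_eq (hl : 1 < l) (hV : GoodPotential l V) {qM : ℝ → ℝ}
    (hq : IsTurningPoint V qM) (hE : V 0 < E) :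
    period V qM E = 2 * orbitInt V (fun _ => 1) E := by
  have hc := continuous_clock hl hV hE
  have hpi := pi_pos
  have h0 : (orbit V 1 1 E 0).1 = 0 := by simp [orbit, rayPoint]
  have h1 := integral_position_eq hl hV hE (a := 0) (b := π / 2) (by linarith) (by linarith) le_rfl
    fun _ => 1
  rw [h0, orbit_pi_div_two hl hV hq hE] at h1
  simp only [one_div, mul_one] at h1
  have h2 : ∫ θ in -(π / 2)..0, clock V 1 1 E θ = ∫ θ in (0 : ℝ)..π / 2, clock V 1 1 E θ := by
    have := intervalIntegral.integral_comp_neg (a := 0) (b := π / 2) fun θ => clock V 1 1 E θ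
    simp only [clock_neg hl hV hE, neg_zero] at this
    exact this.symm
  rw [period, h1, orbitInt_eq hl hV hE continuous_const, intervalIntegral.integral_mul_const,
    ← intervalIntegral.integral_add_adjacent_intervals (hc.intervalIntegrable (-(π / 2)) 0)
      (hc.intervalIntegrable _ _), h2]
  ring

theorem mean_eq_orbitAvg (hl : 1 < l) (hV : GoodPotential l V) {qM : ℝ → ℝ}
    (hq : IsTurningPoint V qM) (hE : V 0 < E) {p : ℝ → ℝ → ℝ}
    (hp : Continuous fun z : ℝ × ℝ => p z.1 z.2) :
    mean V (fun z => p z.1 z.2) E = orbitAvg V qM p E := by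
  have hpi := pi_pos
  have hX : Continuous fun t => orbit V 1 1 E t := continuous_iff_continuousAt.2 fun θ =>
    (orbit_hasDerivAt hl hV one_pos one_pos hE θ).continuousAt
  have h1 := integral_position_eq hl hV hE (a := -(π / 2)) (b := π / 2) le_rfl (by linarith) le_rfl
    fun q => p q √(E - V q) + p q (-√(E - V q))
  rw [orbit_neg_pi_div_two hl hV hq hE, orbit_pi_div_two hl hV hq hE] at h1
  rw [orbitAvg, period_eq hl hV hq hE, h1, mean, orbitInt_eq hl hV hE (hp.comp hX)]
  have h2 : ∀ θ ∈ Set.uIcc (-(π / 2)) (π / 2), clock V 1 1 E θ *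
      (p (orbit V 1 1 E θ).1 √(E - V (orbit V 1 1 E θ).1)
        + p (orbit V 1 1 E θ).1 (-√(E - V (orbit V 1 1 E θ).1)))
      = clock V 1 1 E θ * (p (orbit V 1 1 E θ).1 (orbit V 1 1 E θ).2
        + p (orbit V 1 1 E θ).1 (-(orbit V 1 1 E θ).2)) := fun θ hθ => by
    rw [Set.uIcc_of_le (by linarith)] at hθ
    rw [sqrt_sub_orbit hl hV hE hθ]
  rw [intervalIntegral.integral_congr h2]
  have := (orbitInt_one_pos hl hV hE).ne'
  field_simp

end ChangeOfVariables

section Profile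

variable {l : ℝ} {V : ℝ → ℝ} {E₁ : ℝ} {m : ℝ} {f : ℝ → ℝ}

theorem jap_energy_rpow_le (hl : 1 < l) (hV : GoodPotential l V) (hE₁ : V 0 < E₁) (s : ℝ) :
    ∃ K, 0 ≤ K ∧ ∀ z ∈ above V E₁, jap (energy V z) ^ s ≤ K * wt l (2 * l * s) 0 z := by
  obtain ⟨c, hc, h⟩ := hV.elliptic hl hE₁
  obtain ⟨C, hC, h'⟩ := hV.energy_le hl
  have h0 : 0 < l := by linarith
  have hV0 := abs_nonneg (V 0)
  set K := 1 + C + (1 + |V 0|) / c with hK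
  have hK0 : 0 < K := by positivity
  refine ⟨K ^ |s|, by positivity, fun z hz => ?_⟩
  have hL : 1 ≤ lam l z.1 z.2 ^ (2 * l) := Real.one_le_rpow (one_le_lam h0 _ _) (by linarith)
  have hd : 0 ≤ (1 + |V 0|) / c := by positivity
  have h1 : jap (energy V z) ≤ K * lam l z.1 z.2 ^ (2 * l) := by
    have := jap_le_one_add_abs (energy V z)
    nlinarith [h' z, mul_nonneg hd (zero_le_one.trans hL)]
  have h2 : lam l z.1 z.2 ^ (2 * l) ≤ K * jap (energy V z) := by
    have h3 : lam l z.1 z.2 ^ (2 * l) ≤ (1 + |V 0|) / c * jap (energy V z) := by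
      rw [div_mul_eq_mul_div, le_div_iff₀ hc]
      nlinarith [(h z hz).2, abs_le_jap (energy V z), le_abs_self (energy V z), neg_abs_le (V 0),
        mul_le_mul_of_nonneg_left (one_le_jap (energy V z)) hV0]
    have h4 : 0 ≤ (1 + C) * jap (energy V z) := mul_nonneg (by positivity) (jap_pos _).le
    linarith
  have := rpow_le_of_comparable (jap_pos _) (by positivity) hK0 h1 h2 s
  rwa [← Real.rpow_mul (lam_pos h0 _ _).le, ← mul_one (lam l z.1 z.2 ^ _),
    ← Real.rpow_zero (jap z.1)] at this

theorem symb_deriv_comp_energy (hl : 1 < l) (hV : GoodPotential l V) (hE₁ : V 0 < E₁)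
    (hf : ContDiffOn ℝ (⊤ : ℕ∞) f (Set.Ioi (V 0)))
    (hfS : ∀ k : ℕ, ∃ C : ℝ, ∀ E : ℝ, V 0 < E →
      |iteratedDerivWithin k f (Set.Ioi (V 0)) E| ≤ C * jap E ^ (m / (2 * l) - (k : ℝ))) :
    Symb l (above V E₁) (m - 2 * l) 0 (fun z => deriv f (energy V z)) := by
  have h0 : 0 < l := by linarith
  have hU := isOpen_above (E₁ := E₁) hV
  refine Symb.comp h0 hU (symb_energy hl hV hU) (isOpen_Ioi (a := V 0))
    (fun z hz => hE₁.trans hz) (((contDiffOn_infty_iff_deriv_of_isOpen isOpen_Ioi).1 hf).2)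
    fun k => ?_
  obtain ⟨C, hC⟩ := hfS (k + 1)
  obtain ⟨K, hK, hK'⟩ := jap_energy_rpow_le hl hV hE₁ (m / (2 * l) - ((k + 1 : ℕ) : ℝ))
  refine ⟨|C| * K, fun z hz => ?_⟩
  have hz' : V 0 < energy V z := hE₁.trans hz
  have h1 := hC _ hz'
  rw [iteratedDerivWithin_of_isOpen isOpen_Ioi hz', iteratedDeriv_succ'] at h1
  have h2 := hK' z hz
  rw [show 2 * l * (m / (2 * l) - ((k + 1 : ℕ) : ℝ)) = m - 2 * l - k * (2 * l) by
    push_cast; field_simp; ring] at h2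
  calc _ ≤ _ := h1
    _ ≤ |C| * jap (energy V z) ^ (m / (2 * l) - ((k + 1 : ℕ) : ℝ)) :=
      mul_le_mul_of_nonneg_right (le_abs_self C) (Real.rpow_nonneg (jap_pos _).le _)
    _ ≤ |C| * (K * wt l (m - 2 * l - k * (2 * l)) 0 z) :=
      mul_le_mul_of_nonneg_left h2 (abs_nonneg C)
    _ = _ := by ring

end Profile

/-- The bracket with a function of the energy. -/
theorem pbr_energy_profile {l : ℝ} {V f : ℝ → ℝ} (hV : GoodPotential l V) (ε : ℝ)
    {u : ℝ × ℝ → ℝ} {x ξ : ℝ} (hf : DifferentiableAt ℝ f (ξ ^ 2 + V x))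
    (hu : DifferentiableAt ℝ u (x, ξ)) :
    pbr (fun x' ξ' => (ξ' ^ 2 + V x') + ε * f (ξ' ^ 2 + V x')) (fun x' ξ' => u (x', ξ')) x ξ
      = -((1 + ε * deriv f (ξ ^ 2 + V x)) * flowDeriv V u (x, ξ)) := by
  have h1 : HasDerivAt (fun ξ' : ℝ => ξ' ^ 2 + V x) (2 * ξ) ξ := by
    simpa using ((hasDerivAt_id ξ).pow 2).add_const (V x)
  have h2 : HasDerivAt (fun x' : ℝ => ξ ^ 2 + V x') (deriv V x) x :=
    (hV.hasDerivAt x).const_add (ξ ^ 2)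
  have h3 := h1.add ((hf.hasDerivAt.comp ξ h1).const_mul ε)
  have h4 := h2.add ((hf.hasDerivAt.comp x h2).const_mul ε)
  have e1 : deriv (fun ξ' => (ξ' ^ 2 + V x) + ε * f (ξ' ^ 2 + V x)) ξ = _ := h3.deriv
  have e2 : deriv (fun x' => (ξ ^ 2 + V x') + ε * f (ξ ^ 2 + V x')) x = _ := h4.deriv
  rw [pbr, e1, e2, (deriv_pos_eq hu).deriv, (deriv_mom_eq hu).deriv, flowDeriv]
  ring

/-- Solution of the homological equation, from the solution for the unperturbed energy. -/
theorem exists_homological_solution {l : ℝ} (hl : 1 < l) {V : ℝ → ℝ} (hV : GoodPotential l V)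
    {E₀ n : ℝ} (hE₀ : V 0 < E₀) {p : ℝ × ℝ → ℝ} (hp : ∀ E₁, V 0 < E₁ → Symb l (above V E₁) n 0 p)
    (hvan : ∀ z, energy V z ≤ E₀ → p z = 0) :
    ∃ u : ℝ × ℝ → ℝ, Symb l Set.univ (n - l + 1) 0 u ∧ Symb l Set.univ (n - l) 0 (dPos u) ∧
      (∀ z, energy V z < E₀ → dPos u z = 0 ∧ dMom u z = 0) ∧
      ∀ z, E₀ ≤ energy V z → flowDeriv V u z = p z - mean V p (energy V z) := by
  have h0 : 0 < l := by linarith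
  obtain ⟨E₁, hE₁, hE₁'⟩ := exists_between hE₀
  have hU := isOpen_above (E₁ := E₁) hV
  have hW : IsOpen {z | energy V z < E₀} := isOpen_lt (energy_smooth hV).continuous continuous_const
  have hUW : above V E₁ ∪ {z | energy V z < E₀} = Set.univ := by
    ext z
    simpa [above] using (lt_or_ge E₁ (energy V z)).imp_right fun h => h.trans_lt hE₁'
  obtain ⟨s1, s2⟩ := symb_flowPrim hl hV hE₁ (hp E₁ hE₁)
  classical
  set u : ℝ × ℝ → ℝ := (above V E₁).piecewise (flowPrim V p) 0 with hu
  have eU : Set.EqOn (flowPrim V p) u (above V E₁) := (Set.piecewise_eqOn _ _ _).symm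
  have eW : Set.EqOn u (fun _ => 0) {z | energy V z < E₀} := fun z hz => by
    by_cases h : z ∈ above V E₁
    · rw [← eU h]
      exact flowPrim_eq_zero hl hV (hE₁.trans h) fun w hw => hvan w (by rw [hw]; exact le_of_lt hz)
    · exact Set.piecewise_eq_of_notMem _ _ _ h
  have dW : ∀ z ∈ {z | energy V z < E₀}, dPos u z = 0 := fun z hz => by
    rw [dPos_congr hW eW hz, dPos_const]
  refine ⟨u, (s1.congr hU eU).extend h0 hU hW hUW eW,
    (s2.congr hU (dPos_congr hU eU)).extend h0 hU hW hUW dW,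
    fun z hz => ⟨dW z hz, by rw [dMom_congr hW eW hz, dMom_const]⟩, fun z hz => ?_⟩
  have hzU : z ∈ above V E₁ := hE₁'.trans_le hz
  rw [flowDeriv, ← dPos_congr hU eU hzU, ← dMom_congr hU eU hzU, ← flowDeriv,
    flowDeriv_flowPrim hl hV hE₁.le (hp E₁ hE₁).smooth hzU]

/-- for `l > 1` and `h₁ = h₀ + ε f̃(h₀)` with `f̃ ∈ S̃^m`, `m < l`, and
`1 + ε f̃' ≥ 1/2`, the homological equation `p + {h₁;χ} = ⟨p⟩∘h₀` has a solution
`χ ∈ S^{m₁+[m₂]-l+1,0}` with `∂_xχ ∈ S^{m₁+[m₂]-l,0}`; here `⟨p⟩` is extended by `0`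
for `E ≤ E₀`. -/
theorem stmt2 (l : ℝ) (hl : 1 < l) (V : ℝ → ℝ) (hV : GoodPotential l V)
    (qM : ℝ → ℝ) (hqM : IsTurningPoint V qM)
    (m : ℝ) (hm : m < l) (ft : ℝ → ℝ)
    (hft : ContDiffOn ℝ (⊤ : ℕ∞) ft (Set.Ioi (V 0)))
    (hftS : ∀ k : ℕ, ∃ C : ℝ, ∀ E : ℝ, V 0 < E →
      |iteratedDerivWithin k ft (Set.Ioi (V 0)) E| ≤ C * jap E ^ (m / (2 * l) - (k : ℝ)))
    (ε : ℝ)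
    (hε : ∀ E : ℝ, V 0 < E → (1:ℝ)/2 ≤ 1 + ε * derivWithin ft (Set.Ioi (V 0)) E)
    (m₁ m₂ : ℝ) (p : ℝ → ℝ → ℝ) (hp : IsSymbol l m₁ m₂ p)
    (E₀ : ℝ) (hE₀ : V 0 < E₀)
    (hvan : ∀ x ξ : ℝ, ξ ^ 2 + V x ≤ E₀ → p x ξ = 0) :
    ∃ χ : ℝ → ℝ → ℝ,
      IsSymbol l (m₁ + max m₂ 0 - l + 1) 0 χ ∧
      IsSymbol l (m₁ + max m₂ 0 - l) 0 (fun x ξ => deriv (fun x' => χ x' ξ) x) ∧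
      ∀ x ξ : ℝ,
        p x ξ
          + pbr (fun x' ξ' => (ξ' ^ 2 + V x') + ε * ft (ξ' ^ 2 + V x')) χ x ξ
          = if E₀ < ξ ^ 2 + V x then orbitAvg V qM p (ξ ^ 2 + V x) else 0 := by
  have h0 : 0 < l := by linarith
  have hD : ∀ E, V 0 < E → 1 / 2 ≤ 1 + ε * deriv ft E := fun E hE => by
    have := hε E hE
    rwa [derivWithin_of_isOpen isOpen_Ioi hE] at this
  set b : ℝ → ℝ := fun E => (1 + ε * deriv ft E)⁻¹ with hb
  set P : ℝ × ℝ → ℝ := fun z => p z.1 z.2 with hP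
  have hPs := Symb.of_isSymbol hp
  have hsymb : ∀ E₁, V 0 < E₁ →
      Symb l (above V E₁) (m₁ + max m₂ 0) 0 (fun z => b (energy V z) * P z) := fun E₁ hE₁ => by
    have hU := isOpen_above (E₁ := E₁) hV
    have hd := (symb_deriv_comp_energy hl hV hE₁ hft hftS).weaken (a' := 0) (b' := 0) h0
      (by linarith) (by linarith)
    have hbs := ((Symb.const 1).add hU (hd.const_mul h0 hU ε)).inv h0 hU (c := 1 / 2) (by norm_num)
      fun z hz => by simpa [wt] using hD _ (hE₁.trans hz)
    have hm := hbs.mul h0 hU (hPs.mono (Set.subset_univ _))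
    exact hm.weaken h0 (by linarith [le_max_right m₂ 0]) (by linarith [le_max_left m₂ 0])
  obtain ⟨u, hu, hu', hlow, hflow⟩ := exists_homological_solution hl hV hE₀ hsymb
    fun z hz => by simp only [hP, hvan z.1 z.2 hz, mul_zero]
  have hud : ∀ z, DifferentiableAt ℝ u z := fun z =>
    smooth_differentiableAt isOpen_univ hu.smooth (Set.mem_univ z)
  refine ⟨fun x ξ => u (x, ξ), hu.isSymbol, ?_, fun x ξ => ?_⟩
  · rw [show (fun x ξ => deriv (fun x' => u (x', ξ)) x) = fun x ξ => dPos u (x, ξ) from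
      funext fun x => funext fun ξ => (deriv_pos_eq (hud _)).deriv]
    exact hu'.isSymbol
  rcases lt_or_ge (ξ ^ 2 + V x) E₀ with h | h
  · obtain ⟨e1, e2⟩ := hlow (x, ξ) h
    rw [if_neg h.not_gt, hvan x ξ h.le, pbr, (deriv_pos_eq (hud _)).deriv,
      (deriv_mom_eq (hud _)).deriv, e1, e2]
    ring
  · have hE : V 0 < ξ ^ 2 + V x := hE₀.trans_le h
    have hmean : mean V P (ξ ^ 2 + V x)
        = if E₀ < ξ ^ 2 + V x then orbitAvg V qM p (ξ ^ 2 + V x) else 0 := by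
      split_ifs with h'
      · exact mean_eq_orbitAvg hl hV hqM hE hp.1.continuous
      · exact mean_eq_zero hl hV hE fun z hz => hvan z.1 z.2 (hz.le.trans (not_lt.1 h'))
    have hfd : DifferentiableAt ℝ ft (ξ ^ 2 + V x) :=
      (hft.contDiffAt (Ioi_mem_nhds hE)).differentiableAt (by simp)
    have hne : 1 + ε * deriv ft (ξ ^ 2 + V x) ≠ 0 := by linarith [hD _ hE]
    have hbm : mean V (fun z => b (energy V z) * P z) (ξ ^ 2 + V x)
        = b (ξ ^ 2 + V x) * mean V P (ξ ^ 2 + V x) := mean_comp_mul hl hV hE b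
    rw [pbr_energy_profile hV ε hfd (hud _), hflow (x, ξ) h, ← hmean]
    simp only [energy] at hbm ⊢
    rw [hbm]
    simp only [hb, hP]
    field_simp
    ring
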